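/- arXiv:math/0212333 — 3 statements merged into one kernel-verified Lean document; each statement's English description precedes it below -/
import Mathlib

section
/- Let G be a group such that for all a, b in G, the subgroup ⟨a, aᵇ⟩ is nilpotent. Then the set of 2-elements of G is a subgroup of G. -/
theorem aux_fin (C : Type*) [iC : Group C] [hfg : Group.FG C] (hc : ∀ a b : C, a * b = b * a)
    (ht : ∀ g : C, ∃ k : ℕ, g ^ 2 ^ k = 1) : Finite C := by
  let _ : CommGroup C := { iC with mul_comm := hc }
  exact @CommGroup.finite_of_fg_isMulTorsion C _ hfg (fun g => by
    obtain ⟨k, hk⟩ := ht g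
    exact isOfFinOrder_iff_pow_eq_one.mpr ⟨2 ^ k, by positivity, hk⟩)

theorem aux_nil (G : Type*) [Group G] [Group.IsNilpotent G] :
    ∀ S : Set G, S.Finite → Subgroup.closure S = ⊤ → (∀ s ∈ S, ∃ k : ℕ, s ^ 2 ^ k = 1) →
      Finite G ∧ IsPGroup 2 G := by
  refine Group.nilpotent_center_quotient_ind (P := fun G _ _ =>
    ∀ S : Set G, S.Finite → Subgroup.closure S = ⊤ → (∀ s ∈ S, ∃ k : ℕ, s ^ 2 ^ k = 1) →
      Finite G ∧ IsPGroup 2 G) G ?_ ?_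
  · intro G _ _ S _ _ _
    exact ⟨inferInstance, fun g => ⟨0, Subsingleton.elim _ _⟩⟩
  · intro G _ _ ih S hS hcl hk
    obtain ⟨hfin, hp⟩ := ih (Set.image (QuotientGroup.mk' (Subgroup.center G)) S) (hS.image _)
      (by
        rw [← MonoidHom.map_closure, hcl, Subgroup.map_top_of_surjective]
        exact QuotientGroup.mk'_surjective _)
      (by
        rintro _ ⟨s, hs, rfl⟩
        obtain ⟨k, hk⟩ := hk s hs
        exact ⟨k, by rw [← map_pow, hk, map_one]⟩)
    have : Fact (Nat.Prime 2) := ⟨Nat.prime_two⟩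
    have : (Subgroup.center G).FiniteIndex := Subgroup.finiteIndex_of_finite_quotient
    have : Group.FG G := ⟨⟨hS.toFinset, by simpa using hcl⟩⟩
    obtain ⟨n, hn⟩ := IsPGroup.iff_card.mp hp
    have hidx : (Subgroup.center G).index = 2 ^ n := hn
    have key : ∀ g : G, ∃ k : ℕ, (MonoidHom.transferCenterPow G g) ^ 2 ^ k = 1 := by
      intro g
      have hg : g ∈ Subgroup.closure S := by rw [hcl]; trivial
      induction hg using Subgroup.closure_induction with
      | mem x hx =>
        obtain ⟨k, hk⟩ := hk x hx
        exact ⟨k, by rw [← map_pow, hk, map_one]⟩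
      | one => exact ⟨0, by simp⟩
      | mul x y _ _ hx hy =>
        obtain ⟨k, hk⟩ := hx
        obtain ⟨l, hl⟩ := hy
        refine ⟨k + l, ?_⟩
        have hc : Commute (MonoidHom.transferCenterPow G x) (MonoidHom.transferCenterPow G y) :=
          Subtype.ext ((Subgroup.mem_center_iff.mp (MonoidHom.transferCenterPow G y).2 _))
        rw [map_mul, hc.mul_pow, pow_add, pow_mul, hk, mul_comm (2 ^ k), pow_mul, hl]
        simp
      | inv x _ hx =>
        obtain ⟨k, hk⟩ := hx
        exact ⟨k, by rw [map_inv, inv_pow, hk, inv_one]⟩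
    have hpG : IsPGroup 2 G := by
      intro g
      obtain ⟨k, hk⟩ := key g
      refine ⟨n + k, ?_⟩
      have := congrArg Subtype.val hk
      rw [Subgroup.coe_pow, MonoidHom.transferCenterPow_apply, hidx] at this
      rw [pow_add, pow_mul]
      exact this
    refine ⟨?_, hpG⟩
    have : Group.FG (Subgroup.center G) := inferInstance
    have : Finite (Subgroup.center G) := aux_fin _ (fun a b => Subtype.ext (Subgroup.mem_center_iff.mp b.2 a))
      (hpG.to_subgroup (Subgroup.center G))
    exact Finite.of_equiv _ (Subgroup.groupEquivQuotientProdSubgroup (s := Subgroup.center G)).symm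

theorem aux_two {G : Type*} [Group G] {a c : G} {k : ℕ} (ha : a ^ 2 ^ k = 1) (hc : c ^ 2 ^ k = 1)
    [Group.IsNilpotent (Subgroup.closure ({a, c} : Set G))] :
    IsPGroup 2 (Subgroup.closure ({a, c} : Set G)) := by
  have hfin : (Set.preimage ((↑) : Subgroup.closure ({a, c} : Set G) → G) {a, c}).Finite :=
    ((Set.finite_singleton c).insert a).preimage Subtype.val_injective.injOn
  refine (aux_nil _ _ hfin Subgroup.closure_closure_coe_preimage ?_).2
  rintro s hs
  refine ⟨k, Subtype.ext ?_⟩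
  rw [Subgroup.coe_pow, Subgroup.coe_one]
  rcases hs with hs | hs
  · rw [hs, ha]
  · rw [Set.mem_singleton_iff.mp hs, hc]

theorem stmt_6 {G : Type*} [Group G]
    (h : ∀ a b : G, Group.IsNilpotent ↥(Subgroup.closure {a, b⁻¹ * a * b})) :
    ∃ H : Subgroup G, ∀ g : G, g ∈ H ↔ ∃ k : ℕ, orderOf g = 2 ^ k := by
  have conj : ∀ a b : G, (∃ k : ℕ, a ^ 2 ^ k = 1) →
      ∃ k : ℕ, (b⁻¹ * a * b * a) ^ 2 ^ k = 1 := by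
    rintro a b ⟨k, hk⟩
    have := h a b
    have hb : (b⁻¹ * a * b) ^ 2 ^ k = 1 := by
      have := conj_pow (i := 2 ^ k) (a := b⁻¹) (b := a)
      rw [inv_inv] at this
      rw [this, hk]; simp
    have hp := aux_two hk hb
    have ha : a ∈ Subgroup.closure {a, b⁻¹ * a * b} := Subgroup.subset_closure (by simp)
    have hab : b⁻¹ * a * b ∈ Subgroup.closure {a, b⁻¹ * a * b} :=
      Subgroup.subset_closure (by simp)
    obtain ⟨l, hl⟩ := hp ⟨_, mul_mem hab ha⟩
    exact ⟨l, congrArg Subtype.val hl⟩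
  have hmul : ∀ x y : G, (∃ k : ℕ, x ^ 2 ^ k = 1) → (∃ k : ℕ, y ^ 2 ^ k = 1) →
      ∃ k : ℕ, (x * y) ^ 2 ^ k = 1 := by
    rintro x y ⟨n, hn⟩ hy
    have P : ∀ m : ℕ, ∃ k : ℕ, ((x ^ 2 ^ m)⁻¹ * (x * y) ^ 2 ^ m) ^ 2 ^ k = 1 := by
      intro m
      induction m with
      | zero => simpa using hy
      | succ m ih =>
        have := conj _ (x ^ 2 ^ m) ih
        convert this using 4
        rw [pow_succ, mul_two, pow_add, pow_add]
        group
    obtain ⟨k, hk⟩ := P n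
    rw [hn, inv_one, one_mul, ← pow_mul, ← pow_add] at hk
    exact ⟨_, hk⟩
  refine ⟨{ carrier := {g | ∃ k : ℕ, g ^ 2 ^ k = 1}
            mul_mem' := fun {x y} hx hy => hmul x y hx hy
            one_mem' := ⟨0, by simp⟩
            inv_mem' := ?_ }, ?_⟩
  · rintro x ⟨k, hk⟩
    exact ⟨k, by rw [inv_pow, hk, inv_one]⟩
  · intro g
    change (∃ k : ℕ, g ^ 2 ^ k = 1) ↔ _
    constructor
    · rintro ⟨k, hk⟩
      obtain ⟨j, _, hj⟩ := (Nat.dvd_prime_pow Nat.prime_two).mp (orderOf_dvd_of_pow_eq_one hk)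
      exact ⟨j, hj⟩
    · rintro ⟨k, hk⟩
      exact ⟨k, by rw [← hk, pow_orderOf_eq_one]⟩
end

section
/- Let G be a group satisfying condition (𝒩,3) (every 4 elements of G contain a pair generating a nilpotent subgroup). Then the set T of elements of finite order in G is a subgroup of G, and T is the (restricted) direct product of its subgroups T_p of p-elements, over all primes p. -/
/-- Condition (𝒩,3): every subset of `G` with 4 elements contains a pair generating
a nilpotent subgroup. -/
def CondN3 (G : Type*) [Group G] : Prop :=
  ∀ S : Finset G, S.card = 4 → ∃ x ∈ S, ∃ y ∈ S, x ≠ y ∧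
    Group.IsNilpotent ↥(Subgroup.closure {x, y})

/-- The set of `p`-elements of `G`. -/
def pElems (G : Type*) [Group G] (p : ℕ) : Set G := {g : G | ∃ k : ℕ, orderOf g = p ^ k}

open scoped commutatorElement

/-- `x` and `y` generate a nilpotent subgroup. -/
def Nil2 {G : Type*} [Group G] (x y : G) : Prop :=
  Group.IsNilpotent ↥(Subgroup.closure ({x, y} : Set G))

theorem aux_cent {G : Type*} [Group G] {u g z : G} (hz : Commute z g) (h : u * g * u⁻¹ = z * g)
    {n : ℕ} (hn : Commute u (g ^ n)) : z ^ n = 1 := by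
  have h1 : (u * g * u⁻¹) ^ n = u * g ^ n * u⁻¹ := conj_pow
  rw [h, hz.mul_pow, hn.eq, mul_inv_cancel_right] at h1
  simpa using h1

theorem aux_comm_of_class : ∀ (k : ℕ) (G : Type*) [Group G] [Group.IsNilpotent G],
    Group.nilpotencyClass G ≤ k → ∀ (x y : G) (m n : ℕ), x ^ m = 1 → y ^ n = 1 → m.Coprime n →
    Commute x y := by
  intro k
  induction k with
  | zero =>
    intro G _ _ hk x y m n _ _ _
    have := Group.nilpotencyClass_zero_iff_subsingleton.mp (Nat.le_zero.mp hk)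
    exact Subsingleton.elim _ _
  | succ k ih =>
    intro G _ _ hk x y m n hx hy hmn
    have h1 : Commute (x : G ⧸ Subgroup.center G) (y : G ⧸ Subgroup.center G) := by
      apply ih (G ⧸ Subgroup.center G) _ _ _ m n _ _ hmn
      · rw [Group.nilpotencyClass_quotient_center]; omega
      · rw [← QuotientGroup.mk_pow, hx]; rfl
      · rw [← QuotientGroup.mk_pow, hy]; rfl
    have h2 : ⁅x, y⁆ ∈ Subgroup.center G := by
      rw [← QuotientGroup.eq_one_iff]
      have : ((⁅x, y⁆ : G) : G ⧸ Subgroup.center G)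
        = ⁅(x : G ⧸ Subgroup.center G), (y : G ⧸ Subgroup.center G)⁆ := rfl
      rw [this]
      exact commutatorElement_eq_one_iff_commute.mpr h1
    rw [Subgroup.mem_center_iff] at h2
    have hA : ⁅x, y⁆ ^ n = 1 := by
      apply aux_cent (u := x) (g := y) (h2 y).symm
      · simp [commutatorElement_def]
      · rw [hy]; exact Commute.one_right _
    have hB : ⁅x, y⁆ ^ m = 1 := by
      have : (⁅x, y⁆⁻¹) ^ m = 1 := by
        apply aux_cent (u := y) (g := x)
        · exact (Commute.inv_right (show Commute x _ from h2 x)).symm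
        · simp [commutatorElement_def, mul_assoc]
        · rw [hx]; exact Commute.one_right _
      rwa [inv_pow, inv_eq_one] at this
    have : ⁅x, y⁆ ^ (m.gcd n) = 1 := by
      rw [← orderOf_dvd_iff_pow_eq_one] at *
      exact Nat.dvd_gcd hB hA
    rw [hmn, pow_one] at this
    exact commutatorElement_eq_one_iff_commute.mp this

/-- A nilpotent group generated by `p`-elements is a `p`-group. -/
theorem aux_pgroup (p : ℕ) : ∀ (n : ℕ) (G : Type*) [Group G],
    (⊤ : Subgroup G).lowerCentralSeries (n + 1) = ⊥ →
    ∀ S : Set G, Subgroup.closure S = ⊤ → (∀ s ∈ S, ∃ k : ℕ, s ^ p ^ k = 1) →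
    ∀ g : G, ∃ k : ℕ, g ^ p ^ k = 1 := by
  have key : ∀ (G : Type _) [Group G] (S : Set G), (∀ s ∈ S, ∃ k : ℕ, s ^ p ^ k = 1) →
      (∀ a ∈ Subgroup.closure S, ∀ b ∈ Subgroup.closure S, Commute a b) →
      ∀ g ∈ Subgroup.closure S, ∃ k : ℕ, g ^ p ^ k = 1 := by
    intro G _ S hS hc g hg
    induction hg using Subgroup.closure_induction with
    | mem x hx => exact hS x hx
    | one => exact ⟨0, by simp⟩
    | mul x y hx hy h1 h2 =>
      obtain ⟨a, ha⟩ := h1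
      obtain ⟨b, hb⟩ := h2
      refine ⟨a + b, ?_⟩
      rw [(hc x hx y hy).mul_pow, pow_add, pow_mul, ha, one_pow, mul_comm, pow_mul, hb, one_pow,
        one_mul]
    | inv x hx h1 =>
      obtain ⟨a, ha⟩ := h1
      exact ⟨a, by rw [inv_pow, ha, inv_one]⟩
  intro n
  induction n with
  | zero =>
    intro G _ h S hS hSp g
    refine key G S hSp ?_ g (hS ▸ Subgroup.mem_top g)
    intro a _ b _
    rw [← commutatorElement_eq_one_iff_commute, ← Subgroup.mem_bot, ← h]
    exact Subgroup.commutator_mem_commutator (Subgroup.mem_top a) (Subgroup.mem_top b)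
  | succ n ih =>
    intro G _ h S hS hSp g
    set N := (⊤ : Subgroup G).lowerCentralSeries (n + 1) with hN
    have hcen : ∀ z ∈ N, ∀ g : G, Commute z g := by
      intro z hz g
      rw [← commutatorElement_eq_one_iff_commute, ← Subgroup.mem_bot, ← h]
      exact Subgroup.commutator_mem_commutator hz (Subgroup.mem_top g)
    have hQ : ∀ g : G, ∃ k : ℕ, g ^ p ^ k ∈ N := by
      intro g
      have hsurj : Function.Surjective (QuotientGroup.mk' N) := QuotientGroup.mk'_surjective N
      obtain ⟨k, hk⟩ := ih (G ⧸ N) (by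
          have := Subgroup.map_lowerCentralSeries (⊤ : Subgroup G) (QuotientGroup.mk' N) (n + 1)
          rw [Subgroup.map_top_of_surjective _ hsurj] at this
          rw [← this, ← hN, Subgroup.map_eq_bot_iff, QuotientGroup.ker_mk'])
        (QuotientGroup.mk' N '' S)
        (by rw [← MonoidHom.map_closure, hS, Subgroup.map_top_of_surjective _ hsurj])
        (by
          rintro _ ⟨s, hs, rfl⟩
          obtain ⟨k, hk⟩ := hSp s hs
          exact ⟨k, by rw [← map_pow, hk, map_one]⟩) (QuotientGroup.mk' N g)
      refine ⟨k, ?_⟩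
      rw [← map_pow] at hk
      exact (QuotientGroup.eq_one_iff _).mp hk
    have hNp : ∀ z ∈ N, ∃ k : ℕ, z ^ p ^ k = 1 := by
      have hNc : N = Subgroup.closure
          {x | ∃ a ∈ (⊤ : Subgroup G).lowerCentralSeries n, ∃ b ∈ (⊤ : Subgroup G), ⁅a, b⁆ = x} :=
        Subgroup.commutator_def _ _
      intro z hz
      rw [hNc] at hz
      refine key G _ ?_ ?_ z hz
      · rintro s ⟨u, hu, g, hg, rfl⟩
        have hs : ⁅u, g⁆ ∈ N := Subgroup.commutator_mem_commutator hu hg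
        obtain ⟨k, hk⟩ := hQ g
        refine ⟨k, aux_cent (u := u) (g := g) (hcen _ hs g) (by simp [commutatorElement_def])
          (hcen _ hk u).symm⟩
      · rw [← hNc]
        intro a ha b _
        exact hcen a ha b
    obtain ⟨k, hk⟩ := hQ g
    obtain ⟨l, hl⟩ := hNp _ hk
    exact ⟨k + l, by rw [pow_add, pow_mul, hl]⟩

section
variable {G : Type*} [Group G]

theorem Nil2.of_mem {x y a b : G} (h : Nil2 x y) (ha : a ∈ Subgroup.closure ({x, y} : Set G))
    (hb : b ∈ Subgroup.closure ({x, y} : Set G)) : Nil2 a b := by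
  have hle : Subgroup.closure ({a, b} : Set G) ≤ Subgroup.closure ({x, y} : Set G) := by
    rw [Subgroup.closure_le]
    rintro z (rfl | rfl)
    · exact ha
    · exact hb
  have : Group.IsNilpotent ↥(Subgroup.closure ({x, y} : Set G)) := h
  exact Group.nilpotent_of_mulEquiv (Subgroup.subgroupOfEquivOfLe hle)

theorem mem_cl_left (x y : G) : x ∈ Subgroup.closure ({x, y} : Set G) :=
  Subgroup.subset_closure (by simp)

theorem mem_cl_right (x y : G) : y ∈ Subgroup.closure ({x, y} : Set G) :=
  Subgroup.subset_closure (by simp)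

theorem Nil2.refl (x : G) : Nil2 x x := by
  unfold Nil2
  rw [Set.pair_eq_singleton, ← Subgroup.zpowers_eq_closure]
  let _ : CommGroup (Subgroup.zpowers x) :=
    { (inferInstance : Group (Subgroup.zpowers x)) with
      mul_comm := (Subgroup.zpowers_isMulCommutative x).is_comm.comm }
  exact CommGroup.isNilpotent

theorem Nil2.symm {x y : G} (h : Nil2 x y) : Nil2 y x :=
  h.of_mem (mem_cl_right x y) (mem_cl_left x y)

theorem Nil2.of_word {x y a b : G} (h : Nil2 x y)
    (H : ∀ K : Subgroup G, x ∈ K → y ∈ K → a ∈ K ∧ b ∈ K) : Nil2 a b :=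
  h.of_mem (H _ (mem_cl_left x y) (mem_cl_right x y)).1
    (H _ (mem_cl_left x y) (mem_cl_right x y)).2

theorem Nil2.commute {x y : G} (h : Nil2 x y) {m n : ℕ} (hx : x ^ m = 1) (hy : y ^ n = 1)
    (hmn : m.Coprime n) : Commute x y := by
  have : Group.IsNilpotent ↥(Subgroup.closure ({x, y} : Set G)) := h
  have := aux_comm_of_class _ (Subgroup.closure ({x, y} : Set G)) le_rfl
    ⟨x, mem_cl_left x y⟩ ⟨y, mem_cl_right x y⟩ m n (Subtype.ext hx) (Subtype.ext hy) hmn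
  exact congrArg Subtype.val this

theorem Nil2.mul_p {x y : G} (h : Nil2 x y) {p : ℕ} (hx : ∃ k : ℕ, x ^ p ^ k = 1)
    (hy : ∃ k : ℕ, y ^ p ^ k = 1) {g : G} (hg : g ∈ Subgroup.closure ({x, y} : Set G)) :
    ∃ k : ℕ, g ^ p ^ k = 1 := by
  have h' : Group.IsNilpotent ↥(Subgroup.closure ({x, y} : Set G)) := h
  obtain ⟨n, hn⟩ := Subgroup.nilpotent_iff_lowerCentralSeries.mp h'
  have hn1 := le_bot_iff.mp
    ((Subgroup.lowerCentralSeries_antitone (S := (⊤ : Subgroup ↥(Subgroup.closure ({x, y} : Set G))))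
      (Nat.le_succ n)).trans hn.le)
  obtain ⟨k, hk⟩ := aux_pgroup p n (Subgroup.closure ({x, y} : Set G)) hn1
    (((↑) : Subgroup.closure ({x, y} : Set G) → G) ⁻¹' {x, y})
    (Subgroup.closure_closure_coe_preimage) (by
      rintro ⟨s, hs⟩ (h0 | h0)
      · obtain ⟨k, hk⟩ := hx
        have h1 : s = x := h0
        exact ⟨k, Subtype.ext (by rw [← h1] at hk; exact hk)⟩
      · obtain ⟨k, hk⟩ := hy
        have h1 : s = y := h0
        exact ⟨k, Subtype.ext (by rw [← h1] at hk; exact hk)⟩) ⟨g, hg⟩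
  exact ⟨k, congrArg Subtype.val hk⟩

theorem four (h : CondN3 G) (a b c d : G) :
    Nil2 a b ∨ Nil2 a c ∨ Nil2 a d ∨ Nil2 b c ∨ Nil2 b d ∨ Nil2 c d := by
  classical
  by_contra! hcon
  obtain ⟨h1, h2, h3, h4, h5, h6⟩ := hcon
  have ne : ∀ x y : G, ¬ Nil2 x y → x ≠ y := by
    rintro x y hxy rfl
    exact hxy (Nil2.refl x)
  have e1 := ne _ _ h1
  have e2 := ne _ _ h2
  have e3 := ne _ _ h3
  have e4 := ne _ _ h4
  have e5 := ne _ _ h5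
  have e6 := ne _ _ h6
  obtain ⟨x, hx, y, hy, hxy, hN⟩ := h {a, b, c, d} (by
    rw [Finset.card_eq_succ]
    refine ⟨a, {b, c, d}, by simp [e1, e2, e3], rfl, ?_⟩
    rw [Finset.card_eq_three]
    exact ⟨b, c, d, e4, e5, e6, rfl⟩)
  have hN' : Nil2 x y := hN
  have hN'' := hN'.symm
  simp only [Finset.mem_insert, Finset.mem_singleton] at hx hy
  rcases hx with rfl | rfl | rfl | rfl <;> rcases hy with rfl | rfl | rfl | rfl <;>
    first | exact hxy rfl | contradiction

theorem nil_sq (h : CondN3 G) (a b : G) : Nil2 (a ^ 2) b := by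
  rcases four h a b (a * b) (a ^ 2 * b) with H | H | H | H | H | H
  · exact H.of_word fun K h1 h2 => ⟨pow_mem h1 2, h2⟩
  · exact H.of_word fun K h1 h2 => ⟨pow_mem h1 2, (Subgroup.mul_mem_cancel_left K h1).mp h2⟩
  · exact H.of_word fun K h1 h2 =>
      ⟨pow_mem h1 2, (Subgroup.mul_mem_cancel_left K (pow_mem h1 2)).mp h2⟩
  · exact H.of_word fun K h1 h2 =>
      ⟨pow_mem ((Subgroup.mul_mem_cancel_right K h1).mp h2) 2, h1⟩
  · exact H.of_word fun K h1 h2 => ⟨(Subgroup.mul_mem_cancel_right K h1).mp h2, h1⟩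
  · refine H.of_word fun K h1 h2 => ?_
    have ha : a ∈ K := by
      have : a = (a ^ 2 * b) * (a * b)⁻¹ := by group
      rw [this]; exact mul_mem h2 (inv_mem h1)
    exact ⟨pow_mem ha 2, (Subgroup.mul_mem_cancel_left K ha).mp h1⟩

theorem nil_conj (h : CondN3 G) (a b : G) : Nil2 a (b⁻¹ * a * b) := by
  have fin : ∀ K : Subgroup G, a ∈ K → b ∈ K → a ∈ K ∧ b⁻¹ * a * b ∈ K :=
    fun K ha hb => ⟨ha, mul_mem (mul_mem (inv_mem hb) ha) hb⟩
  rcases four h a b (a * b) (b⁻¹ * a * b) with H | H | H | H | H | H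
  · exact H.of_word fin
  · exact H.of_word fun K h1 h2 => fin K h1 ((Subgroup.mul_mem_cancel_left K h1).mp h2)
  · exact H
  · exact H.of_word fun K h1 h2 => fin K ((Subgroup.mul_mem_cancel_right K h1).mp h2) h1
  · refine H.of_word fun K h1 h2 => fin K ?_ h1
    have : a = b * (b⁻¹ * a * b) * b⁻¹ := by group
    rw [this]; exact mul_mem (mul_mem h1 h2) (inv_mem h1)
  · refine H.of_word fun K h1 h2 => ?_
    have hb : b ∈ K := by
      have : b = (a * b) * (b⁻¹ * a * b)⁻¹ := by group
      rw [this]; exact mul_mem h1 (inv_mem h2)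
    exact fin K ((Subgroup.mul_mem_cancel_right K hb).mp h1) hb

theorem nil_odd (h : CondN3 G) {x y : G} {n : ℕ} (hn : Odd n) (hx : x ^ n = 1) : Nil2 x y := by
  obtain ⟨m, rfl⟩ := hn
  have : x = (x ^ (m + 1)) ^ 2 := by
    rw [← pow_mul, show (m + 1) * 2 = (2 * m + 1) + 1 by ring, pow_succ, hx, one_mul]
  rw [this]
  exact nil_sq h _ _

theorem comm_coprime (h : CondN3 G) {x y : G} {m n : ℕ} (hx : x ^ m = 1) (hy : y ^ n = 1)
    (hmn : m.Coprime n) : Commute x y := by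
  rcases Nat.even_or_odd m with hm | hm
  · rcases Nat.even_or_odd n with hn | hn
    · have := Nat.dvd_gcd hm.two_dvd hn.two_dvd
      rw [hmn] at this
      omega
    · exact ((nil_odd h hn hy).commute hy hx hmn.symm).symm
  · exact (nil_odd h hm hx).commute hx hy hmn

theorem mem_pElems {p : ℕ} (hp : p.Prime) {g : G} : g ∈ pElems G p ↔ ∃ k : ℕ, g ^ p ^ k = 1 := by
  constructor
  · rintro ⟨k, hk⟩
    exact ⟨k, by rw [← hk, pow_orderOf_eq_one]⟩
  · rintro ⟨k, hk⟩
    obtain ⟨j, _, hj⟩ := (Nat.dvd_prime_pow hp).mp (orderOf_dvd_of_pow_eq_one hk)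
    exact ⟨j, hj⟩

theorem p_div (h : CondN3 G) {p : ℕ} (hp : p.Prime) {x y : G} (hx : ∃ k : ℕ, x ^ p ^ k = 1)
    (hy : ∃ k : ℕ, y ^ p ^ k = 1) : ∃ k : ℕ, (x * y⁻¹) ^ p ^ k = 1 := by
  rcases hp.eq_two_or_odd' with rfl | hodd
  · have hc : ∃ k : ℕ, (y⁻¹ * x * y) ^ 2 ^ k = 1 := by
      obtain ⟨k, hk⟩ := hx
      refine ⟨k, ?_⟩
      have h2 : (y⁻¹ * x * y⁻¹⁻¹) ^ 2 ^ k = y⁻¹ * x ^ 2 ^ k * y⁻¹⁻¹ := conj_pow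
      rw [inv_inv] at h2
      rw [h2, hk]; simp
    have hw := (nil_conj h x y).mul_p hx hc (mul_mem (mem_cl_left _ _) (mem_cl_right _ _))
    have hy2 : ∃ k : ℕ, (y ^ 2) ^ 2 ^ k = 1 := by
      obtain ⟨k, hk⟩ := hy
      exact ⟨k, by rw [← pow_mul, mul_comm, pow_mul, hk, one_pow]⟩
    obtain ⟨k, hk⟩ := (nil_sq h y (x * (y⁻¹ * x * y))).mul_p hy2 hw
      (mul_mem (mem_cl_right _ _) (inv_mem (mem_cl_left _ _)))
    refine ⟨k + 1, ?_⟩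
    rw [pow_succ', pow_mul, ← hk]
    congr 1
    simp only [pow_two]
    group
  · obtain ⟨k, hk⟩ := hx
    exact (nil_odd h (hodd.pow (n := k)) hk : Nil2 x y).mul_p ⟨k, hk⟩ hy
      (mul_mem (mem_cl_left _ _) (inv_mem (mem_cl_right _ _)))

/-- The subgroup of `p`-elements. -/
def TpSub (h : CondN3 G) {p : ℕ} (hp : p.Prime) : Subgroup G :=
  Subgroup.ofDiv (pElems G p) ⟨1, (mem_pElems hp).mpr ⟨0, by simp⟩⟩ (by
    intro x hx y hy
    rw [mem_pElems hp] at *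
    exact p_div h hp hx hy)

theorem noncommProd_zpow (g : G) (e : ℕ → ℤ) (s : Finset ℕ)
    (hc : (s : Set ℕ).Pairwise (Function.onFun Commute fun i => g ^ e i)) :
    s.noncommProd (fun i => g ^ e i) hc = g ^ (∑ i ∈ s, e i) := by
  classical
  induction s using Finset.induction_on with
  | empty => simp
  | insert a s ha ih =>
    rw [Finset.noncommProd_insert_of_notMem _ _ _ _ ha, Finset.sum_insert ha, ih, zpow_add]

theorem exists_exp (n : ℕ) (hn : n ≠ 0) : ∃ e : ℕ → ℤ, (∀ p, ¬ p.Prime → e p = 0) ∧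
    (∀ p : ℕ, (n : ℤ) ∣ e p * (p : ℤ) ^ n.factorization p) ∧
    ∃ s : Finset ℕ, (∀ p, e p ≠ 0 → p ∈ s) ∧ (n : ℤ) ∣ 1 - ∑ i ∈ s, e i := by
  classical
  rcases eq_or_ne n 1 with rfl | h1
  · exact ⟨fun _ => 0, by simp, by simp, ∅, by simp, by simp⟩
  have hne : n.primeFactors.Nonempty := by
    rw [Nat.nonempty_primeFactors]; omega
  obtain ⟨μ, hμ⟩ := (exists_sum_eq_one_iff_pairwise_coprime (R := ℤ)
    (s := fun p : ℕ => (p : ℤ) ^ n.factorization p) hne).mpr (by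
      rintro ⟨a, ha⟩ ⟨b, hb⟩ hab
      have hab' : a ≠ b := fun e => hab (Subtype.ext e)
      exact (Nat.isCoprime_iff_coprime.mpr ((Nat.coprime_primes (Nat.prime_of_mem_primeFactors ha)
        (Nat.prime_of_mem_primeFactors hb)).mpr hab')).pow)
  have hprod : ∏ p ∈ n.primeFactors, (p : ℤ) ^ n.factorization p = n := by
    have := Nat.prod_factorization_pow_eq_self hn
    rw [Finsupp.prod, Nat.support_factorization] at this
    exact_mod_cast this
  refine ⟨fun p => if p ∈ n.primeFactors then
    μ p * ∏ j ∈ n.primeFactors \ {p}, (j : ℤ) ^ n.factorization j else 0, ?_, ?_,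
    n.primeFactors, ?_, ?_⟩
  · intro p hp
    exact if_neg fun h => hp (Nat.prime_of_mem_primeFactors h)
  · intro p
    dsimp only
    split_ifs with hp
    · rw [mul_assoc, Finset.sdiff_singleton_eq_erase, Finset.prod_erase_mul _ _ hp, hprod]
      exact dvd_mul_left _ _
    · simp
  · intro p hp
    by_contra hcon
    exact hp (if_neg hcon)
  · rw [Finset.sum_congr rfl (fun i hi => if_pos hi), hμ, sub_self]
    exact dvd_zero _

/-- Primary decomposition of an element of finite order. -/
theorem exists_decomp {g : G} (hg : IsOfFinOrder g) : ∃ f : ℕ → G,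
    (∀ p : ℕ, ¬ p.Prime → f p = 1) ∧ (∀ p : ℕ, p.Prime → f p ∈ pElems G p) ∧
    ∃ hc : ∀ p q : ℕ, Commute (f p) (f q),
    ∃ s : Finset ℕ, (∀ p : ℕ, f p ≠ 1 → p ∈ s) ∧
      g = s.noncommProd f (fun a _ b _ _ => hc a b) := by
  obtain ⟨e, he1, he2, s, hs, hsum⟩ := exists_exp (orderOf g) hg.orderOf_pos.ne'
  refine ⟨fun p => g ^ e p, fun p hp => by simp [he1 p hp], fun p hp => ?_,
    fun p q => Commute.zpow_zpow_self g _ _, s, fun p hp => hs p ?_, ?_⟩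
  · rw [mem_pElems hp]
    refine ⟨(orderOf g).factorization p, ?_⟩
    rw [← zpow_natCast, ← zpow_mul, ← orderOf_dvd_iff_zpow_eq_one]
    exact_mod_cast he2 p
  · rintro h0
    exact hp (by simp [h0])
  · refine Eq.trans ?_ (noncommProd_zpow g e s _).symm
    rw [← div_eq_one, div_eq_mul_inv]
    nth_rewrite 1 [← zpow_one g]
    rw [← zpow_sub, ← orderOf_dvd_iff_zpow_eq_one]
    exact hsum

theorem mul_fin (h : CondN3 G) {p : ℕ} (hp : p.Prime) {x g : G} (hx : x ∈ pElems G p) {n : ℕ}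
    (hn : n ≠ 0) (hg : g ^ n = 1) : ∃ k : ℕ, (x * g) ^ (n * p ^ k) = 1 := by
  obtain ⟨A, B, ⟨j, hA⟩, hprod, hc⟩ : ∃ A B : ℕ, (∃ j, A = p ^ j) ∧ A * B = n ∧ p.Coprime B :=
    ⟨p ^ n.factorization p, n / p ^ n.factorization p, ⟨_, rfl⟩,
      Nat.ordProj_mul_ordCompl_eq_self n p, Nat.coprime_ordCompl hp hn⟩
  have hcop : IsCoprime (A : ℤ) (B : ℤ) :=
    Nat.isCoprime_iff_coprime.mpr (hA ▸ hc.pow_left _)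
  obtain ⟨a, b, hab⟩ := hcop
  have hgn : ∀ c : ℤ, g ^ (c * n) = 1 := by
    intro c
    rw [mul_comm, zpow_mul, zpow_natCast, hg, one_zpow]
  have hgg : g = g ^ (b * B) * g ^ (a * A) := by
    rw [← zpow_add, add_comm, hab, zpow_one]
  have h1 : (g ^ (b * B)) ^ p ^ j = 1 := by
    rw [← hA, ← zpow_natCast, ← zpow_mul, ← hgn b, ← hprod]
    push_cast
    ring_nf
  have h2 : (g ^ (a * A)) ^ B = 1 := by
    rw [← zpow_natCast, ← zpow_mul, ← hgn a, ← hprod]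
    push_cast
    ring_nf
  have hm : x * g ^ (b * B) ∈ TpSub h hp :=
    mul_mem (show x ∈ TpSub h hp from hx)
      (show g ^ (b * B) ∈ TpSub h hp from (mem_pElems hp).mpr ⟨j, h1⟩)
  obtain ⟨k, hk⟩ := (mem_pElems hp).mp (show x * g ^ (b * B) ∈ pElems G p from hm)
  have hcomm := comm_coprime h hk h2 (hc.pow_left k)
  refine ⟨k, ?_⟩
  rw [hgg, ← mul_assoc, hcomm.mul_pow]
  have e1 : (x * g ^ (b * (B : ℤ))) ^ (n * p ^ k) = 1 := by
    rw [mul_comm n, pow_mul, hk, one_pow]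
  have e2 : (g ^ (a * (A : ℤ))) ^ (n * p ^ k) = 1 := by
    rw [← hprod, mul_comm A B, mul_assoc, pow_mul, h2, one_pow]
  rw [e1, e2, one_mul]

/-- The subgroup generated by `p`-elements, `p` in a set `P` of primes, is torsion. -/
theorem closure_fin (h : CondN3 G) (P : Set ℕ) (hP : ∀ p ∈ P, p.Prime) (M : ℕ)
    (hM : ∀ p ∈ P, p.Coprime M) {g : G} (hg : g ∈ Subgroup.closure (⋃ p ∈ P, pElems G p)) :
    ∃ n : ℕ, n ≠ 0 ∧ n.Coprime M ∧ g ^ n = 1 := by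
  have step : ∀ x ∈ (⋃ p ∈ P, pElems G p), ∀ y : G, (∃ n : ℕ, n ≠ 0 ∧ n.Coprime M ∧ y ^ n = 1) →
      ∃ n : ℕ, n ≠ 0 ∧ n.Coprime M ∧ (x * y) ^ n = 1 := by
    intro x hx y ⟨n, hn, hnM, hy⟩
    simp only [Set.mem_iUnion] at hx
    obtain ⟨p, hp, hx⟩ := hx
    obtain ⟨k, hk⟩ := mul_fin h (hP p hp) hx hn hy
    exact ⟨n * p ^ k, mul_ne_zero hn (pow_ne_zero _ (hP p hp).ne_zero),
      hnM.mul_left ((hM p hp).pow_left k), hk⟩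
  induction hg using Subgroup.closure_induction_left with
  | one => exact ⟨1, one_ne_zero, Nat.coprime_one_left M, by simp⟩
  | mul_left x hx y hy ih => exact step x hx y ih
  | inv_mul_cancel x hx y hy ih =>
    refine step x⁻¹ ?_ y ih
    simp only [Set.mem_iUnion] at hx ⊢
    obtain ⟨p, hp, k, hk⟩ := hx
    exact ⟨p, hp, k, by rw [orderOf_inv, hk]⟩

theorem indep (h : CondN3 G) (p : ℕ) (hp : p.Prime) :
    Subgroup.closure (pElems G p) ⊓
      Subgroup.closure (⋃ q ∈ {q : ℕ | q.Prime ∧ q ≠ p}, pElems G q) = ⊥ := by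
  rw [eq_bot_iff]
  rintro g ⟨h1, h2⟩
  have h1' : g ∈ TpSub h hp :=
    (Subgroup.closure_le (TpSub h hp)).mpr (fun x hx => hx) h1
  obtain ⟨k, hk⟩ := (mem_pElems hp).mp (show g ∈ pElems G p from h1')
  obtain ⟨n, _, hn, hgn⟩ := closure_fin h {q : ℕ | q.Prime ∧ q ≠ p} (fun q hq => hq.1) p
    (fun q hq => (Nat.coprime_primes hq.1 hp).mpr hq.2) h2
  have hd := Nat.dvd_gcd (orderOf_dvd_of_pow_eq_one hgn) (orderOf_dvd_of_pow_eq_one hk)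
  rw [(hn.pow_right k : n.gcd (p ^ k) = 1), Nat.dvd_one, orderOf_eq_one_iff] at hd
  exact Subgroup.mem_bot.mpr hd

theorem split_off {g : G} {f : ℕ → G} (h1 : ∀ p : ℕ, ¬ p.Prime → f p = 1)
    (h2 : ∀ p : ℕ, p.Prime → f p ∈ pElems G p) (hc : ∀ p q : ℕ, Commute (f p) (f q))
    (s : Finset ℕ) (hs : ∀ p : ℕ, f p ≠ 1 → p ∈ s)
    (hg : g = s.noncommProd f (fun a _ b _ _ => hc a b)) (p : ℕ) :
    ∃ r ∈ Subgroup.closure (⋃ q ∈ {q : ℕ | q.Prime ∧ q ≠ p}, pElems G q), g = f p * r := by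
  classical
  have hmem : ∀ q, q ≠ p →
      f q ∈ Subgroup.closure (⋃ q ∈ {q : ℕ | q.Prime ∧ q ≠ p}, pElems G q) := by
    intro q hq
    by_cases hqp : q.Prime
    · apply Subgroup.subset_closure
      simp only [Set.mem_iUnion]
      exact ⟨q, ⟨hqp, hq⟩, h2 q hqp⟩
    · rw [h1 q hqp]; exact one_mem _
  by_cases hp : p ∈ s
  · refine ⟨(s.erase p).noncommProd f (fun a _ b _ _ => hc a b), ?_, ?_⟩
    · exact Subgroup.noncommProd_mem _ _ fun q hq => hmem q (Finset.ne_of_mem_erase hq)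
    · exact hg.trans (Finset.mul_noncommProd_erase s hp f _ _).symm
  · refine ⟨g, ?_, ?_⟩
    · rw [hg]
      exact Subgroup.noncommProd_mem _ _ fun q hq => hmem q (fun e => hp (e ▸ hq))
    · have : f p = 1 := by
        by_contra hcon
        exact hp (hs p hcon)
      rw [this, one_mul]

end

theorem stmt_7 {G : Type*} [Group G] (h : CondN3 G) :
    -- T, the set of elements of finite order, is a subgroup
    (∃ T : Subgroup G, (∀ g : G, g ∈ T ↔ IsOfFinOrder g) ∧
      -- each T_p is a subgroup
      (∀ p : ℕ, p.Prime → ∃ Tp : Subgroup G, (Tp : Set G) = pElems G p) ∧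
      -- elements of T_p and T_q commute for p ≠ q
      (∀ p q : ℕ, p.Prime → q.Prime → p ≠ q →
        ∀ x ∈ pElems G p, ∀ y ∈ pElems G q, x * y = y * x) ∧
      -- T is generated by the T_p
      (T = Subgroup.closure (⋃ p ∈ {p : ℕ | p.Prime}, pElems G p)) ∧
      -- restricted direct product: each T_p meets the product of the others trivially
      (∀ p : ℕ, p.Prime →
        Subgroup.closure (pElems G p) ⊓
          Subgroup.closure (⋃ q ∈ {q : ℕ | q.Prime ∧ q ≠ p}, pElems G q) = ⊥) ∧
      -- every element of T decomposes uniquely as a product of commuting p-elements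
      ∀ g ∈ T, ∃! f : ℕ → G,
        (∀ p : ℕ, ¬ p.Prime → f p = 1) ∧ (∀ p : ℕ, p.Prime → f p ∈ pElems G p) ∧
        ∃ hc : ∀ p q : ℕ, Commute (f p) (f q),
        ∃ s : Finset ℕ, (∀ p : ℕ, f p ≠ 1 → p ∈ s) ∧
          g = s.noncommProd f (fun a _ b _ _ => hc a b)) := by
  have hT : ∀ g : G, g ∈ Subgroup.closure (⋃ p ∈ {p : ℕ | p.Prime}, pElems G p) ↔
      IsOfFinOrder g := by
    intro g
    constructor
    · intro hg
      obtain ⟨n, hn, _, hgn⟩ := closure_fin h {p : ℕ | p.Prime} (fun p hp => hp) 1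
        (fun p _ => Nat.coprime_one_right p) hg
      exact isOfFinOrder_iff_pow_eq_one.mpr ⟨n, Nat.pos_of_ne_zero hn, hgn⟩
    · intro hg
      obtain ⟨f, h1, h2, hc, s, hs, hgf⟩ := exists_decomp hg
      rw [hgf]
      refine Subgroup.noncommProd_mem _ _ fun q _ => ?_
      by_cases hqp : q.Prime
      · apply Subgroup.subset_closure
        simp only [Set.mem_iUnion]
        exact ⟨q, hqp, h2 q hqp⟩
      · rw [h1 q hqp]; exact one_mem _
  refine ⟨Subgroup.closure (⋃ p ∈ {p : ℕ | p.Prime}, pElems G p), hT,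
    fun p hp => ⟨TpSub h hp, rfl⟩, ?_, rfl, indep h, ?_⟩
  · intro p q hp hq hpq x hx y hy
    obtain ⟨a, ha⟩ := (mem_pElems hp).mp hx
    obtain ⟨b, hb⟩ := (mem_pElems hq).mp hy
    exact comm_coprime h ha hb (((Nat.coprime_primes hp hq).mpr hpq).pow a b)
  · intro g hg
    obtain ⟨f, h1, h2, hc, s, hs, hgf⟩ := exists_decomp ((hT g).mp hg)
    refine ⟨f, ⟨h1, h2, hc, s, hs, hgf⟩, ?_⟩
    rintro f' ⟨h1', h2', hc', s', hs', hgf'⟩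
    funext p
    by_cases hp : p.Prime
    · obtain ⟨r, hr, hgr⟩ := split_off h1 h2 hc s hs hgf p
      obtain ⟨r', hr', hgr'⟩ := split_off h1' h2' hc' s' hs' hgf' p
      have e : (f' p)⁻¹ * f p = r' * r⁻¹ := by
        rw [inv_mul_eq_iff_eq_mul, ← mul_assoc, ← hgr', hgr, mul_inv_cancel_right]
      have hb : (f' p)⁻¹ * f p ∈ Subgroup.closure (pElems G p) ⊓
          Subgroup.closure (⋃ q ∈ {q : ℕ | q.Prime ∧ q ≠ p}, pElems G q) := by
        refine Subgroup.mem_inf.mpr ⟨mul_mem (inv_mem (Subgroup.subset_closure (h2' p hp)))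
          (Subgroup.subset_closure (h2 p hp)), ?_⟩
        rw [e]
        exact mul_mem hr' (inv_mem hr)
      rw [indep h p hp, Subgroup.mem_bot, inv_mul_eq_one] at hb
      exact hb
    · rw [h1 p hp, h1' p hp]
end

section
/- Let G be a group satisfying condition (𝒩,3) and the maximal condition on abelian subgroups. Then G is nilpotent. -/
open Subgroup
open scoped commutatorElement

namespace N3

/-- Every subgroup of `C` is finitely generated. -/
def SN {G : Type*} [Group G] (C : Subgroup G) : Prop := ∀ K : Subgroup G, K ≤ C → K.FG

/-- Every abelian subgroup is finitely generated. -/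
def MaxAb (G : Type*) [Group G] : Prop :=
  ∀ H : Subgroup G, (∀ x ∈ H, ∀ y ∈ H, x * y = y * x) → H.FG

/-- Locally nilpotent. -/
def LN (G : Type*) [Group G] : Prop := ∀ H : Subgroup G, H.FG → Group.IsNilpotent H

/-- The consequence of (N,3) that we use. -/
def PSq (G : Type*) [Group G] : Prop :=
  ∀ x y : G, Group.IsNilpotent (closure {x, y ^ 2})

variable {G Q : Type*} [Group G] [Group Q]

lemma fg_map {K : Subgroup G} (h : K.FG) (f : G →* Q) : (K.map f).FG := by
  classical
  obtain ⟨S, rfl⟩ := h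
  exact ⟨S.image f, by rw [MonoidHom.map_closure]; simp⟩

lemma fg_lift (f : G →* Q) (K : Subgroup G) (L : Subgroup Q) (hL : L.FG) (hLK : L ≤ K.map f) :
    ∃ M : Subgroup G, M ≤ K ∧ M.FG ∧ M.map f = L := by
  classical
  obtain ⟨S, rfl⟩ := hL
  have h1 : (S : Set Q) ⊆ f '' (K : Set G) := fun x hx => hLK (subset_closure hx)
  obtain ⟨T, hT, hTS⟩ := Finset.subset_set_image_iff.mp h1
  refine ⟨closure T, (closure_le _).2 hT, ⟨T, rfl⟩, ?_⟩
  rw [MonoidHom.map_closure, ← hTS]; simp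

lemma fg_ext (f : G →* Q) (K : Subgroup G) (h1 : (K.map f).FG) (h2 : (K ⊓ f.ker).FG) :
    K.FG := by
  obtain ⟨M, hMK, hM, hMf⟩ := fg_lift f K _ h1 le_rfl
  have : K = M ⊔ (K ⊓ f.ker) := by
    apply le_antisymm
    · intro x hx
      have : f x ∈ M.map f := by rw [hMf]; exact mem_map_of_mem f hx
      obtain ⟨m, hm, hmx⟩ := this
      have : x = m * (m⁻¹ * x) := by group
      rw [this]
      refine mul_mem_sup hm (mem_inf.2 ⟨mul_mem (inv_mem (hMK hm)) hx, ?_⟩)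
      simp [MonoidHom.mem_ker, hmx]
    · exact sup_le hMK inf_le_left
  rw [this]
  exact hM.sup h2

lemma fg_of_map {f : G →* Q} (hf : Function.Injective f) {K : Subgroup G}
    (h : (K.map f).FG) : K.FG := by
  apply fg_ext f K h
  rw [(MonoidHom.ker_eq_bot_iff f).2 hf, inf_bot_eq]
  exact Subgroup.FG.bot

lemma SN.mono {A B : Subgroup G} (h : SN B) (hAB : A ≤ B) : SN A := fun _ hK => h _ (hK.trans hAB)

lemma MaxAb.sn (h : MaxAb G) {A : Subgroup G} (hA : ∀ x ∈ A, ∀ y ∈ A, x * y = y * x) : SN A :=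
  fun K hK => h K fun x hx y hy => hA x (hK hx) y (hK hy)

lemma MaxAb.of_injective (h : MaxAb Q) {f : G →* Q} (hf : Function.Injective f) : MaxAb G := by
  intro H hH
  apply fg_of_map hf
  apply h
  rintro _ ⟨x, hx, rfl⟩ _ ⟨y, hy, rfl⟩
  rw [← map_mul, hH x hx y hy, map_mul]

lemma SN.comap {f : G →* Q} (hf : Function.Injective f) {C : Subgroup Q} (h : SN C) :
    SN (C.comap f) := fun _ hK => fg_of_map hf (h _ (map_le_iff_le_comap.2 hK))

lemma SN.map {f : G →* Q} {C : Subgroup G} (h : SN C) : SN (C.map f) := by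
  intro K hK
  have : K = ((K.comap f) ⊓ C).map f := by
    apply le_antisymm
    · intro x hx
      obtain ⟨c, hc, rfl⟩ := hK hx
      exact ⟨c, ⟨hx, hc⟩, rfl⟩
    · rintro _ ⟨c, hc, rfl⟩
      exact hc.1
  rw [this]
  exact fg_map (h _ inf_le_right) f

/-- A finitely generated subgroup of a directed union lies in a member. -/
lemma fg_le_iSup {ι : Type*} [Nonempty ι] {f : ι → Subgroup G} (hf : Directed (· ≤ ·) f)
    {K : Subgroup G} (hK : K.FG) (h : K ≤ ⨆ i, f i) : ∃ i, K ≤ f i := by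
  classical
  obtain ⟨S, rfl⟩ := hK
  have h1 : ∀ x ∈ S, x ∈ ⨆ i, f i := fun x hx => h (subset_closure hx)
  clear h
  have : ∃ i, ∀ x ∈ S, x ∈ f i := by
    induction S using Finset.induction_on with
    | empty => exact ⟨Classical.arbitrary ι, by simp⟩
    | insert a s ha ih =>
      obtain ⟨i, hi⟩ := ih fun x hx => h1 x (Finset.mem_insert_of_mem hx)
      obtain ⟨j, hj⟩ := (mem_iSup_of_directed hf).1 (h1 a (Finset.mem_insert_self _ _))
      obtain ⟨k, hik, hjk⟩ := hf i j
      refine ⟨k, fun x hx => ?_⟩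
      rcases Finset.mem_insert.1 hx with rfl | hx
      · exact hjk hj
      · exact hik (hi x hx)
  obtain ⟨i, hi⟩ := this
  exact ⟨i, (closure_le _).2 hi⟩

lemma nilp_of_le {A B : Subgroup G} (h : Group.IsNilpotent B) (hAB : A ≤ B) :
    Group.IsNilpotent A := by
  have : Group.IsNilpotent (A.subgroupOf B) := inferInstance
  exact (Group.isNilpotent_congr (subgroupOfEquivOfLe hAB)).1 this

lemma nilp_map {A : Subgroup G} (h : Group.IsNilpotent A) (f : G →* Q) :
    Group.IsNilpotent (A.map f) :=
  Group.nilpotent_of_surjective (f.subgroupMap A) (f.subgroupMap_surjective A)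

lemma nilp_of_comm {A : Subgroup G} (h : ∀ x ∈ A, ∀ y ∈ A, x * y = y * x) :
    Group.IsNilpotent A := by
  let _ : CommGroup A := { (inferInstance : Group A) with
    mul_comm := fun a b => Subtype.ext (h a a.2 b b.2) }
  exact CommGroup.isNilpotent

lemma nilp_of_map {A : Subgroup G} {f : G →* Q} (hf : Function.Injective f)
    (h : Group.IsNilpotent (A.map f)) : Group.IsNilpotent A :=
  (Group.isNilpotent_congr (A.equivMapOfInjective f hf)).2 h

lemma PSq.of_injective (h : PSq Q) {f : G →* Q} (hf : Function.Injective f) : PSq G := by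
  intro x y
  apply nilp_of_map hf
  rw [MonoidHom.map_closure, Set.image_pair, map_pow]
  exact h _ _

lemma PSq.of_surjective (h : PSq G) {f : G →* Q} (hf : Function.Surjective f) : PSq Q := by
  intro x y
  obtain ⟨x, rfl⟩ := hf x
  obtain ⟨y, rfl⟩ := hf y
  have := nilp_map (h x y) f
  rwa [MonoidHom.map_closure, Set.image_pair, map_pow] at this

lemma nilp_closure_pair {x y : G} (h : x * y = y * x) : Group.IsNilpotent (closure {x, y}) := by
  have : IsMulCommutative (closure {x, y}) := by
    apply isMulCommutative_closure
    rintro a (rfl | rfl) b (rfl | rfl) <;> simp [h]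
  apply nilp_of_comm
  intro a ha b hb
  exact congrArg Subtype.val (this.is_comm.comm ⟨a, ha⟩ ⟨b, hb⟩)

lemma psq_of_condN3 (h : CondN3 G) : PSq G := by
  classical
  intro x y
  by_cases hc : x * y = y * x
  · apply nilp_closure_pair
    exact (Commute.pow_right hc 2)
  have hxy : x ≠ y := by rintro rfl; exact hc rfl
  have h1 : y ≠ 1 := by rintro rfl; simp at hc
  have h2 : x ≠ 1 := by rintro rfl; simp at hc
  have h3 : y ≠ x * y ^ 2 := by
    intro he
    apply hc
    have : x = y⁻¹ := by
      have : y * (y ^ 2)⁻¹ = x := by rw [mul_inv_eq_iff_eq_mul]; exact he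
      rw [← this]; group
    rw [this]; simp
  by_cases h4 : y ^ 2 = 1
  · rw [h4]; exact nilp_closure_pair (by simp)
  have hle : closure {x, y ^ 2} ≤ closure {x, y} := by
    rw [closure_le]
    rintro a (rfl | rfl)
    · exact subset_closure (by simp)
    · exact pow_mem (subset_closure (by simp)) 2
  have key : ∀ a b : G, Group.IsNilpotent (closure {a, b}) → x ∈ closure {a, b} →
      y ^ 2 ∈ closure {a, b} → Group.IsNilpotent (closure {x, y ^ 2}) := by
    intro a b hn h1 h2
    apply nilp_of_le hn
    rw [closure_le]
    rintro c (rfl | rfl)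
    · exact h1
    · exact h2
  have kk : ∀ a b : G, Group.IsNilpotent (closure {a, b}) → (∀ H : Subgroup G, a ∈ H → b ∈ H → x ∈ H ∧ y ^ 2 ∈ H) →
     Group.IsNilpotent (closure {x, y ^ 2}) := by
    intro a b hn hh
    have := hh (closure {a, b}) (subset_closure (by simp)) (subset_closure (by simp))
    exact key a b hn this.1 this.2
  have e1 : ∀ H : Subgroup G, x ∈ H → y ∈ H → x ∈ H ∧ y ^ 2 ∈ H :=
    fun H hx hy => ⟨hx, pow_mem hy 2⟩
  have e2 : ∀ H : Subgroup G, x ∈ H → x * y ∈ H → x ∈ H ∧ y ^ 2 ∈ H :=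
    fun H hx hy => e1 H hx ((mul_mem_cancel_left hx).1 hy)
  have e3 : ∀ H : Subgroup G, x ∈ H → x * y ^ 2 ∈ H → x ∈ H ∧ y ^ 2 ∈ H :=
    fun H hx hy => ⟨hx, ((mul_mem_cancel_left hx).1 hy)⟩
  have e4 : ∀ H : Subgroup G, y ∈ H → x * y ∈ H → x ∈ H ∧ y ^ 2 ∈ H :=
    fun H hx hy => e1 H ((mul_mem_cancel_right hx).1 hy) hx
  have e5 : ∀ H : Subgroup G, y ∈ H → x * y ^ 2 ∈ H → x ∈ H ∧ y ^ 2 ∈ H :=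
    fun H hx hy => e1 H ((mul_mem_cancel_right (pow_mem hx 2)).1 hy) hx
  have e6 : ∀ H : Subgroup G, x * y ∈ H → x * y ^ 2 ∈ H → x ∈ H ∧ y ^ 2 ∈ H := by
    intro H hx hy
    have : x * y ^ 2 = (x * y) * y := by rw [pow_two, mul_assoc]
    rw [this] at hy
    exact e4 H ((mul_mem_cancel_left hx).1 hy) hx
  have hcard : ({x, y, x * y, x * y ^ 2} : Finset G).card = 4 := by
    have hp : y ≠ y ^ 2 := by
      intro h; apply h1; rw [pow_two] at h; exact (left_eq_mul.1 h)
    rw [Finset.card_insert_of_notMem, Finset.card_insert_of_notMem, Finset.card_pair]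
    · simpa using hp
    · simp [h2, h3]
    · simp [hxy, h1, h4]
  obtain ⟨a, ha, b, hb, hab, hn⟩ := h _ hcard
  simp only [Finset.mem_insert, Finset.mem_singleton] at ha hb
  rcases ha with rfl | rfl | rfl | rfl <;> rcases hb with rfl | rfl | rfl | rfl <;>
    first
    | exact absurd rfl hab
    | exact kk _ _ hn (by assumption)
    | exact kk _ _ hn (fun H p q => by
        first
        | exact e1 H q p
        | exact e2 H q p
        | exact e3 H q p
        | exact e4 H q p
        | exact e5 H q p
        | exact e6 H q p)

lemma maxAb_of_chain (hmax : ∀ f : ℕ → Subgroup G, Monotone f →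
      (∀ n, ∀ x ∈ f n, ∀ y ∈ f n, x * y = y * x) →
      ∃ n, ∀ m, n ≤ m → f m = f n) : MaxAb G := by
  classical
  intro H hH
  by_contra hfg
  have step : ∀ S : Finset G, (S : Set G) ⊆ H → ∃ x ∈ H, x ∉ closure (S : Set G) := by
    intro S hS
    by_contra! hcon
    exact hfg ⟨S, le_antisymm ((closure_le _).2 hS) hcon⟩
  choose! g hg1 hg2 using step
  obtain ⟨s, hs0, hs⟩ : ∃ s : ℕ → Finset G, s 0 = ∅ ∧ ∀ n, s (n + 1) = insert (g (s n)) (s n) :=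
    ⟨fun n => Nat.rec ∅ (fun _ S => insert (g S) S) n, rfl, fun n => rfl⟩
  have hsH : ∀ n, (↑(s n) : Set G) ⊆ (H : Set G) := by
    intro n
    induction n with
    | zero => simp [hs0]
    | succ n ih =>
      rw [hs, Finset.coe_insert]
      exact Set.insert_subset (hg1 _ ih) ih
  obtain ⟨n, hn⟩ := hmax (fun n => Subgroup.closure (↑(s n) : Set G))
    (monotone_nat_of_le_succ fun n => closure_mono (by rw [hs]; simp))
    (fun n x hx y hy => hH x ((closure_le _).2 (hsH n) hx) y ((closure_le _).2 (hsH n) hy))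
  apply hg2 (s n) (hsH n)
  have := hn (n + 1) (by omega)
  rw [← this]
  exact subset_closure (by rw [hs]; simp)

lemma sn_step {C A : Subgroup G} {a : G} (h0 : ∀ c ∈ C, ∀ z ∈ A, c * z = z * c)
    (hA : ∀ x ∈ A, ∀ y ∈ A, x * y = y * x) (hca : ∀ c ∈ C, c * a * c⁻¹ * a⁻¹ ∈ A)
    (hsA : SN A) (hsC : SN (C ⊓ centralizer {a})) : SN C := by
  intro K hK
  let f : K →* G := MonoidHom.mk' (fun c => (c : G) * a * (c : G)⁻¹ * a⁻¹) (by
    rintro ⟨c, hc⟩ ⟨d, hd⟩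
    have e1 := h0 c (hK hc) _ (hca d (hK hd))
    have e2 := hA _ (hca c (hK hc)) _ (hca d (hK hd))
    simp only [MulMemClass.mk_mul_mk, mul_inv_rev]
    rw [e2]
    calc c * d * a * (d⁻¹ * c⁻¹) * a⁻¹ = (c * (d * a * d⁻¹ * a⁻¹)) * (a * c⁻¹ * a⁻¹) := by group
      _ = _ := by rw [e1]; group)
  have hf : ∀ c : K, f c = (c : G) * a * (c : G)⁻¹ * a⁻¹ := fun c => rfl
  have h1 : (⊤ : Subgroup K).FG := by
    apply fg_ext f
    · apply hsA
      rintro _ ⟨c, -, rfl⟩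
      exact hca c (hK c.2)
    · apply fg_of_map K.subtype_injective
      apply hsC
      rintro _ ⟨c, hc, rfl⟩
      have hc2 : f c = 1 := hc.2
      rw [hf, mul_inv_eq_one, mul_inv_eq_iff_eq_mul] at hc2
      refine mem_inf.2 ⟨hK c.2, ?_⟩
      rw [mem_centralizer_singleton_iff]
      exact hc2
  have := fg_map h1 K.subtype
  rwa [← MonoidHom.range_eq_map, range_subtype] at this

lemma sn_steps {C A B : Subgroup G} (h0 : ∀ c ∈ C, ∀ z ∈ A, c * z = z * c)
    (hA : ∀ x ∈ A, ∀ y ∈ A, x * y = y * x) (hca : ∀ c ∈ C, ∀ a ∈ B, c * a * c⁻¹ * a⁻¹ ∈ A)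
    (hsA : SN A) (hB : B.FG) (hsC : SN (C ⊓ centralizer B)) : SN C := by
  classical
  obtain ⟨S, rfl⟩ := hB
  rw [centralizer_closure] at hsC
  have hS : ∀ a ∈ S, ∀ c ∈ C, c * a * c⁻¹ * a⁻¹ ∈ A :=
    fun a ha c hc => hca c hc a (subset_closure ha)
  clear hca
  induction S using Finset.induction_on generalizing C with
  | empty =>
    refine hsC.mono (le_inf le_rfl ?_)
    intro x _
    rw [mem_centralizer_iff]
    simp
  | insert a s ha ih =>
    refine sn_step (a := a) h0 hA (hS a (by simp)) hsA ?_
    refine ih (fun c hc => h0 c hc.1) (hsC.mono ?_)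
      (fun b hb c hc => hS b (Finset.mem_insert_of_mem hb) c hc.1)
    intro x hx
    obtain ⟨⟨hx1, hx2⟩, hx3⟩ := hx
    refine ⟨hx1, ?_⟩
    intro m hm
    rw [Finset.coe_insert] at hm
    rcases hm with rfl | hm
    · exact hx2 m rfl
    · exact hx3 m hm

/-- union of the finite terms of the upper central series -/
def W (G : Type*) [Group G] : Subgroup G := ⨆ n, Subgroup.upperCentralSeries G n

lemma mem_W {x : G} : x ∈ W G ↔ ∃ n, x ∈ Subgroup.upperCentralSeries G n :=
  mem_iSup_of_directed (Subgroup.upperCentralSeries_mono G).directed_le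

lemma W_normal : (W G).Normal := by
  refine ⟨fun x hx g => ?_⟩
  obtain ⟨n, hn⟩ := mem_W.1 hx
  exact mem_W.2 ⟨n, Normal.conj_mem inferInstance x hn g⟩

lemma exists_max_normal_abelian : ∃ A : Subgroup G, A.Normal ∧ (∀ x ∈ A, ∀ y ∈ A, x * y = y * x) ∧
    A ≤ W G ∧ W G ⊓ centralizer A ≤ A := by
  obtain ⟨A, -, hA⟩ := zorn_le_nonempty₀
    {A : Subgroup G | A.Normal ∧ (∀ x ∈ A, ∀ y ∈ A, x * y = y * x) ∧ A ≤ W G} (by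
      intro c hc hch y hy
      have hne : c.Nonempty := ⟨y, hy⟩
      have hmem : ∀ x, x ∈ sSup c ↔ ∃ s ∈ c, x ∈ s := fun x => mem_sSup_of_directedOn hne hch.directedOn
      refine ⟨sSup c, ⟨⟨?_⟩, ?_, sSup_le fun s hs => (hc hs).2.2⟩, fun z hz => le_sSup hz⟩
      · intro x hx g
        obtain ⟨s, hs, hxs⟩ := (hmem x).1 hx
        exact (hmem _).2 ⟨s, hs, (hc hs).1.conj_mem x hxs g⟩
      · intro x hx z hz
        obtain ⟨s, hs, hxs⟩ := (hmem x).1 hx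
        obtain ⟨t, ht, hzt⟩ := (hmem z).1 hz
        rcases hch.total hs ht with h | h
        · exact (hc ht).2.1 x (h hxs) z hzt
        · exact (hc hs).2.1 x hxs z (h hzt)) ⊥
    ⟨inferInstance, by simp [mem_bot], bot_le⟩
  obtain ⟨⟨hN, hcomm, hW⟩, hmax⟩ := hA
  refine ⟨A, hN, hcomm, hW, ?_⟩
  have key : ∀ n, ∀ c ∈ Subgroup.upperCentralSeries G n, c ∈ centralizer (A : Set G) → c ∈ A := by
    intro n
    induction n with
    | zero => intro c hc _; rw [Subgroup.upperCentralSeries_zero, mem_bot] at hc; rw [hc]; exact one_mem _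
    | succ n ih =>
      intro c hc hcA
      have hcen : (centralizer (A : Set G)).Normal := inferInstance
      have hbr : ∀ g, g * c * g⁻¹ * c⁻¹ ∈ A := by
        intro g
        apply ih
        · have := inv_mem (hc g)
          rwa [commutatorElement_inv, commutatorElement_def] at this
        · exact mul_mem (hcen.conj_mem c hcA g) (inv_mem hcA)
      have hle : A ⊔ zpowers c ≤ A := by
        refine hmax ⟨⟨?_⟩, ?_, ?_⟩ le_sup_left
        · intro x hx g
          obtain ⟨a, ha, z, hz, rfl⟩ := mem_sup_of_normal_left.1 hx
          obtain ⟨k, rfl⟩ := mem_zpowers_iff.1 hz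
          have e : g * (a * c ^ k) * g⁻¹ = (g * a * g⁻¹) * (g * c * g⁻¹) ^ k := by
            rw [conj_zpow]; group
          rw [e]
          refine mul_mem (mem_sup_left (hN.conj_mem a ha g)) (zpow_mem ?_ k)
          have e2 : g * c * g⁻¹ = (g * c * g⁻¹ * c⁻¹) * c := by group
          rw [e2]
          exact mul_mem (mem_sup_left (hbr g)) (mem_sup_right (mem_zpowers c))
        · intro x hx y hy
          obtain ⟨a, ha, z, hz, rfl⟩ := mem_sup_of_normal_left.1 hx
          obtain ⟨k, rfl⟩ := mem_zpowers_iff.1 hz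
          obtain ⟨b, hb, z, hz, rfl⟩ := mem_sup_of_normal_left.1 hy
          obtain ⟨l, rfl⟩ := mem_zpowers_iff.1 hz
          have h1 : Commute a b := hcomm a ha b hb
          have h2 : Commute a c := hcA a ha
          have h3 : Commute b c := hcA b hb
          exact (h1.mul_right (h2.zpow_right l)).mul_left
            ((h3.symm.zpow_left k).mul_right ((Commute.refl c).zpow_zpow k l))
        · refine sup_le hW ?_
          rw [zpowers_le]
          exact mem_W.2 ⟨_, hc⟩
      exact hle (mem_sup_right (mem_zpowers c))
  rintro c ⟨hc, hcA⟩
  obtain ⟨n, hn⟩ := mem_W.1 hc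
  exact key n c hn hcA

lemma sn_W (h : MaxAb G) : SN (W G) := by
  obtain ⟨A, hN, hcomm, hW, hcen⟩ := exists_max_normal_abelian (G := G)
  obtain ⟨m, hm⟩ := fg_le_iSup (Subgroup.upperCentralSeries_mono G).directed_le (h A hcomm) hW
  have hsA := h.sn hcomm
  have key : ∀ k, k ≤ m →
      SN (W G ⊓ centralizer ((A ⊓ Subgroup.upperCentralSeries G (m - k) : Subgroup G) : Set G)) := by
    intro k
    induction k with
    | zero =>
      intro _
      rw [Nat.sub_zero, inf_eq_left.2 hm]
      exact hsA.mono hcen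
    | succ k ih =>
      intro hk
      have ih := ih (by omega)
      have hj : m - k = (m - (k + 1)) + 1 := by omega
      rw [hj] at ih
      set j := m - (k + 1) with hjd
      refine sn_steps (A := A ⊓ Subgroup.upperCentralSeries G j) (B := A ⊓ Subgroup.upperCentralSeries G (j + 1))
        ?_ ?_ ?_ ?_ ?_ ?_
      · intro c hc z hz
        exact (hc.2 z hz).symm
      · intro x hx y hy
        exact hcomm x hx.1 y hy.1
      · intro c hc a ha
        refine mem_inf.2 ⟨?_, ?_⟩
        · exact mul_mem (hN.conj_mem a ha.1 c) (inv_mem ha.1)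
        · have := inv_mem (ha.2 c)
          rwa [commutatorElement_inv, commutatorElement_def] at this
      · exact hsA.mono inf_le_left
      · exact hsA _ inf_le_left
      · exact ih.mono (inf_le_inf_right _ inf_le_left)
  have := key m le_rfl
  rw [Nat.sub_self, Subgroup.upperCentralSeries_zero, inf_bot_eq] at this
  refine this.mono (le_inf le_rfl ?_)
  intro x _
  rw [mem_centralizer_iff]
  simp

lemma sn_of_nilp (h : MaxAb G) (U : Subgroup G) (hU : Group.IsNilpotent U) : SN U := by
  have h1 := sn_W (h.of_injective U.subtype_injective)
  obtain ⟨n, hn⟩ := Group.IsNilpotent.nilpotent U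
  have h2 : W U = ⊤ := by
    rw [eq_top_iff, ← hn]
    exact le_iSup _ n
  rw [h2] at h1
  have := h1.map (f := U.subtype)
  rwa [← MonoidHom.range_eq_map, range_subtype] at this

lemma W_stable (h : (W G).FG) : ∃ n, W G = Subgroup.upperCentralSeries G n := by
  obtain ⟨n, hn⟩ := fg_le_iSup (Subgroup.upperCentralSeries_mono G).directed_le h le_rfl
  exact ⟨n, le_antisymm hn (le_iSup _ n)⟩

/-- If `G / W` has trivial centre implies trivial, then `G` is nilpotent. -/
lemma nilp_of_center (h : (W G).FG)
    (hq : ∀ n, W G = Subgroup.upperCentralSeries G n → Nontrivial (G ⧸ Subgroup.upperCentralSeries G n) →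
      center (G ⧸ Subgroup.upperCentralSeries G n) ≠ ⊥) : Group.IsNilpotent G := by
  obtain ⟨n, hn⟩ := W_stable h
  refine ⟨n, ?_⟩
  by_contra hne
  have hnt : Nontrivial (G ⧸ Subgroup.upperCentralSeries G n) := QuotientGroup.nontrivial_iff.2 hne
  apply hq n hn hnt
  have h1 : Subgroup.upperCentralSeries G (n + 1) =
      comap (QuotientGroup.mk' (Subgroup.upperCentralSeries G n)) (center _) :=
    Subgroup.upperCentralSeriesStep_eq_comap_center (Subgroup.upperCentralSeries G n)
  have h2 : Subgroup.upperCentralSeries G (n + 1) ≤ Subgroup.upperCentralSeries G n := hn ▸ le_iSup _ (n + 1)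
  rw [eq_bot_iff]
  intro z hz
  obtain ⟨g, rfl⟩ := QuotientGroup.mk'_surjective _ z
  have : g ∈ Subgroup.upperCentralSeries G (n + 1) := by rw [h1]; exact hz
  rw [mem_bot]
  exact (QuotientGroup.eq_one_iff g).2 (h2 this)

lemma comm_pow {x y : G} (h : Commute x ⁅x, y⁆) (m : ℕ) : ⁅x ^ m, y⁆ = ⁅x, y⁆ ^ m := by
  induction m with
  | zero => simp
  | succ m ih =>
    have e : ⁅x ^ (m + 1), y⁆ = x * ⁅x ^ m, y⁆ * x⁻¹ * ⁅x, y⁆ := by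
      simp only [commutatorElement_def, pow_succ']; group
    rw [e, ih, (h.pow_right m).eq, pow_succ]; group

lemma center_pure [Group.IsNilpotent G] {m : ℕ} (htf : ∀ z ∈ center G, z ^ m = 1 → z = 1)
    {x : G} (hx : x ^ m ∈ center G) : x ∈ center G := by
  have P : ∀ k, ∀ x ∈ Subgroup.upperCentralSeries G (k + 1),
      x ^ m ∈ Subgroup.upperCentralSeries G k → x ∈ Subgroup.upperCentralSeries G k := by
    intro k
    induction k with
    | zero =>
      intro x hx hxm
      rw [zero_add, Subgroup.upperCentralSeries_one] at hx
      rw [Subgroup.upperCentralSeries_zero, mem_bot] at hxm ⊢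
      exact htf x hx hxm
    | succ k ih =>
      intro x hx hxm y
      apply ih _ (hx y)
      have h1 : ⁅x ^ m, y⁆ ∈ Subgroup.upperCentralSeries G k := hxm y
      have h2 : ⁅⁅x, y⁆, x⁆ ∈ Subgroup.upperCentralSeries G k := hx y x
      let π := QuotientGroup.mk' (Subgroup.upperCentralSeries G k)
      have hπ : ∀ g, π g = 1 ↔ g ∈ Subgroup.upperCentralSeries G k :=
        fun g => QuotientGroup.eq_one_iff g
      rw [← hπ, map_commutatorElement] at h1 h2
      rw [← hπ, map_pow]
      rw [map_commutatorElement] at h2 ⊢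
      rw [commutatorElement_eq_one_iff_commute] at h2
      rw [← comm_pow h2.symm, ← map_pow, h1]
  obtain ⟨n, hn⟩ := Group.IsNilpotent.nilpotent G
  have Q : ∀ j, x ∈ Subgroup.upperCentralSeries G (1 + j) → x ∈ Subgroup.upperCentralSeries G 1 := by
    intro j
    induction j with
    | zero => exact id
    | succ j ih =>
      intro h
      apply ih
      apply P _ _ h
      rw [← Subgroup.upperCentralSeries_one] at hx
      exact Subgroup.upperCentralSeries_mono G (show 1 ≤ 1 + j by omega) hx
  rw [← Subgroup.upperCentralSeries_one]
  apply Q n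
  apply Subgroup.upperCentralSeries_mono G (show n ≤ 1 + n by omega)
  rw [hn]; exact mem_top _

lemma exists_max_abelian (G : Type*) [Group G] : ∃ E : Subgroup G,
    (∀ x ∈ E, ∀ y ∈ E, x * y = y * x) ∧ centralizer (E : Set G) ≤ E := by
  obtain ⟨A, -, hA⟩ := zorn_le_nonempty₀
    {A : Subgroup G | (∀ x ∈ A, ∀ y ∈ A, x * y = y * x)} (by
      intro c hc hch y hy
      have hne : c.Nonempty := ⟨y, hy⟩
      have hmem : ∀ x, x ∈ sSup c ↔ ∃ s ∈ c, x ∈ s := fun x => mem_sSup_of_directedOn hne hch.directedOn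
      refine ⟨sSup c, ?_, fun z hz => le_sSup hz⟩
      intro x hx z hz
      obtain ⟨s, hs, hxs⟩ := (hmem x).1 hx
      obtain ⟨t, ht, hzt⟩ := (hmem z).1 hz
      rcases hch.total hs ht with h | h
      · exact (hc ht) x (h hxs) z hzt
      · exact (hc hs) x hxs z (h hzt)) ⊥
    (by simp [mem_bot])
  obtain ⟨hcomm, hmax⟩ := hA
  refine ⟨A, hcomm, fun c hc => ?_⟩
  have hle : closure (insert c (A : Set G)) ≤ A := by
    refine hmax ?_ (fun x hx => subset_closure (Or.inr hx))
    have : IsMulCommutative (closure (insert c (A : Set G))) := by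
      apply isMulCommutative_closure
      rintro a (rfl | ha) b (rfl | hb)
      · rfl
      · exact (hc b hb).symm
      · exact hc a ha
      · exact hcomm a ha b hb
    intro a ha b hb
    exact congrArg Subtype.val (this.is_comm.comm ⟨a, ha⟩ ⟨b, hb⟩)
  exact hle (subset_closure (Or.inl rfl))

lemma exists_maximal_of_sn {E : Subgroup G} (hE : SN E) (p : Subgroup G → Prop)
    (hp : ∀ M, p M → M ≤ E) (h0 : p ⊥) : ∃ M, Maximal p M := by
  obtain ⟨M, -, hM⟩ := zorn_le_nonempty₀ {M | p M} (by
    intro c hc hch y hy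
    have : Nonempty c := ⟨⟨y, hy⟩⟩
    have hle : sSup c ≤ E := sSup_le fun s hs => hp s (hc hs)
    have hfg := hE _ hle
    rw [sSup_eq_iSup'] at hfg
    obtain ⟨i, hi⟩ := fg_le_iSup hch.directed hfg le_rfl
    exact ⟨i, hc i.2, fun z hz => (le_iSup (fun i : c => (i : Subgroup G)) ⟨z, hz⟩).trans hi⟩) ⊥ h0
  exact ⟨M, hM⟩

lemma finite_torsion {E : Subgroup G} (hE : SN E) (hcomm : ∀ x ∈ E, ∀ y ∈ E, x * y = y * x) :
    {t : G | t ∈ E ∧ IsOfFinOrder t}.Finite := by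
  let T : Subgroup G :=
    { carrier := {t : G | t ∈ E ∧ IsOfFinOrder t}
      one_mem' := ⟨one_mem _, IsOfFinOrder.one⟩
      mul_mem' := fun {a b} ha hb => ⟨mul_mem ha.1 hb.1,
        Commute.isOfFinOrder_mul (hcomm a ha.1 b hb.1) ha.2 hb.2⟩
      inv_mem' := fun {a} ha => ⟨inv_mem ha.1, ha.2.inv⟩ }
  have hT : T.FG := hE T fun x hx => hx.1
  let _ : CommGroup T := { (inferInstance : Group T) with
    mul_comm := fun a b => Subtype.ext (hcomm a a.2.1 b b.2.1) }
  have : Group.FG T := (Group.fg_iff_subgroup_fg T).2 hT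
  have : Finite T := CommGroup.finite_of_fg_isMulTorsion T (by
    rintro ⟨t, ht⟩
    exact (Submonoid.isOfFinOrder_coe (H := T.toSubmonoid) (x := ⟨t, ht⟩)).1 ht.2)
  exact Set.toFinite (T : Set G)

lemma center_ne_bot_of_LN [Nontrivial G] (h : MaxAb G) (hL : LN G) : center G ≠ ⊥ := by
  classical
  intro hbot
  have hnc : ∀ z : G, z ≠ 1 → ∃ g, g * z ≠ z * g := by
    intro z hz
    by_contra! hcon
    exact hz (by rw [← mem_bot, ← hbot, mem_center_iff]; exact hcon)
  choose! w hw using hnc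
  obtain ⟨E, hcomm, hcen⟩ := exists_max_abelian G
  have hsE := h.sn hcomm
  have hEfg := h E hcomm
  have hEne : E ≠ ⊥ := by
    rintro rfl
    obtain ⟨x, hx⟩ := exists_ne (1 : G)
    apply hx
    have : x ∈ centralizer ((⊥ : Subgroup G) : Set G) := by
      rw [mem_centralizer_iff]; simp
    exact (mem_bot.1 (hcen this))
  have hCE : ∀ F : Subgroup G, E ≤ F → centralizer (F : Set G) ≤ E :=
    fun F hF => (centralizer_le hF).trans hcen
  have hcenter : ∀ F : Subgroup G, E ≤ F → ∀ z (hz : z ∈ F),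
      (⟨z, hz⟩ : F) ∈ center F ↔ z ∈ centralizer (F : Set G) := by
    intro F hF z hz
    rw [mem_center_iff, mem_centralizer_iff]
    constructor
    · intro h g hg
      exact congrArg Subtype.val (h ⟨g, hg⟩)
    · intro h g
      exact Subtype.ext (h g g.2)
  have hne : ∀ F : Subgroup G, F.FG → E ≤ F → ∃ z ∈ centralizer (F : Set G), z ≠ 1 := by
    intro F hF hEF
    have := hL F hF
    have : Nontrivial F := by
      rw [nontrivial_iff_ne_bot]
      rintro rfl
      exact hEne (le_bot_iff.1 hEF)
    have hb := Group.IsNilpotent.center_ne_bot F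
    obtain ⟨⟨z, hz⟩, hz1, hz2⟩ := Subgroup.ne_bot_iff_exists_ne_one.1 hb |>.elim
      (fun a ha => (⟨a.1, a.2, fun hh => ha (Subtype.ext hh)⟩ : ∃ z : F, z ∈ center F ∧ z ≠ 1))
    exact ⟨z, (hcenter F hEF z hz).1 hz1, fun hh => hz2 (Subtype.ext hh)⟩
  by_cases hA : ∀ F : Subgroup G, F.FG → E ≤ F →
      ∃ t ∈ centralizer (F : Set G), t ≠ 1 ∧ IsOfFinOrder t
  · have hT := finite_torsion hsE hcomm
    obtain ⟨t, ht, ht1, ht2⟩ := hA (E ⊔ closure (hT.toFinset.image w : Finset G))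
      (hEfg.sup ⟨_, rfl⟩) le_sup_left
    apply hw t ht1
    apply ht
    apply mem_sup_right
    apply Subgroup.subset_closure
    have : t ∈ E := hCE _ le_sup_left ht
    rw [Finset.mem_coe]
    exact Finset.mem_image_of_mem w (by simp [this, ht2])
  · push Not at hA
    obtain ⟨F0, hF0, hEF0, htf⟩ := hA
    have hpure : ∀ F : Subgroup G, F.FG → F0 ≤ F → ∀ x ∈ E, ∀ m : ℕ, 0 < m →
        x ^ m ∈ centralizer (F : Set G) → x ∈ centralizer (F : Set G) := by
      intro F hF hFF x hx m hm hxm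
      have hEF := hEF0.trans hFF
      have := hL F hF
      rw [← hcenter F hEF x (hEF hx)]
      refine center_pure (m := m) ?_ ?_
      · rintro ⟨z, hz⟩ hzc hzm
        rw [hcenter F hEF] at hzc
        by_contra hz1
        refine htf z (centralizer_le hFF hzc) (fun hh => hz1 (Subtype.ext hh)) ?_
        exact isOfFinOrder_iff_pow_eq_one.2 ⟨m, hm, congrArg Subtype.val hzm⟩
      · exact (hcenter F hEF (x ^ m) (hEF (pow_mem hx m))).2 hxm
    obtain ⟨M, hM, hMmax⟩ := exists_maximal_of_sn hsE
      (fun M => M ≤ E ∧ ∃ F : Subgroup G, F.FG ∧ F0 ≤ F ∧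
        ∀ x ∈ M, x ∈ centralizer (F : Set G) → x = 1)
      (fun M hM => hM.1) ⟨bot_le, F0, hF0, le_rfl, fun x hx _ => mem_bot.1 hx⟩
    obtain ⟨hME, F, hF, hFF, hMF⟩ := hM
    obtain ⟨z, hz, hz1⟩ := hne F hF (hEF0.trans hFF)
    have hzE : z ∈ E := hCE F (hEF0.trans hFF) hz
    have hle : F ≤ F ⊔ closure ({w z} : Set G) := le_sup_left
    have hF'fg : (F ⊔ closure ({w z} : Set G)).FG := hF.sup ⟨{w z}, by simp⟩
    set F' := F ⊔ closure ({w z} : Set G) with hF'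
    have hzF' : z ∉ centralizer (F' : Set G) := by
      intro hh
      exact hw z hz1 (hh (w z) (mem_sup_right (subset_closure rfl)))
    have hpow : ∀ k : ℤ, z ^ k ∈ centralizer (F' : Set G) → k = 0 := by
      intro k hk
      by_contra hk0
      apply hzF'
      refine hpure F' hF'fg (hFF.trans hle) z hzE k.natAbs (Int.natAbs_pos.2 hk0) ?_
      rcases Int.natAbs_eq k with hh | hh
      · rw [hh, zpow_natCast] at hk; exact hk
      · rw [hh, zpow_neg, zpow_natCast] at hk; exact inv_mem_iff.1 hk
    have hbig : M ⊔ zpowers z ≤ M := by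
      refine hMmax ⟨sup_le hME (by rwa [zpowers_le]), F', hF'fg, hFF.trans hle, ?_⟩ le_sup_left
      intro x hx hxF
      have : M ≤ E := hME
      have hx' : ∃ m ∈ M, ∃ k : ℤ, m * z ^ k = x := by
        let L : Subgroup G :=
          { carrier := {x | ∃ m ∈ M, ∃ k : ℤ, m * z ^ k = x}
            one_mem' := ⟨1, one_mem _, 0, by simp⟩
            mul_mem' := by
              rintro _ _ ⟨m, hm, k, rfl⟩ ⟨n, hn, l, rfl⟩
              refine ⟨m * n, mul_mem hm hn, k + l, ?_⟩
              have : Commute (z ^ k) n := hcomm _ (zpow_mem hzE k) _ (hME hn)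
              rw [zpow_add]
              calc m * n * (z ^ k * z ^ l) = m * (n * z ^ k) * z ^ l := by group
                _ = _ := by rw [← this.eq]; group
            inv_mem' := by
              rintro _ ⟨m, hm, k, rfl⟩
              refine ⟨m⁻¹, inv_mem hm, -k, ?_⟩
              have : Commute (z ^ k) m := hcomm _ (zpow_mem hzE k) _ (hME hm)
              rw [← this.eq, mul_inv_rev, zpow_neg] }
        have : M ⊔ zpowers z ≤ L := sup_le (fun m hm => ⟨m, hm, 0, by simp⟩)
          (by rw [zpowers_le]; exact ⟨1, one_mem _, 1, by simp⟩)
        exact this hx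
      obtain ⟨m, hm, k, rfl⟩ := hx'
      have hm1 : m = 1 := by
        apply hMF m hm
        have h1 := centralizer_le hle hxF
        exact (mul_mem_cancel_right (zpow_mem hz k)).1 h1
      subst hm1
      rw [one_mul] at hxF ⊢
      rw [hpow k hxF, zpow_zero]
    exact hz1 (hMF z (hbig (mem_sup_right (mem_zpowers z))) hz)

lemma ucs_subgroupOf (B : Subgroup G) (n : ℕ) :
    ∀ x : B, (x : G) ∈ Subgroup.upperCentralSeries G n → x ∈ Subgroup.upperCentralSeries B n := by
  induction n with
  | zero =>
    intro x hx
    rw [Subgroup.upperCentralSeries_zero, mem_bot] at hx ⊢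
    exact Subtype.ext hx
  | succ n ih =>
    intro x hx y
    exact ih _ (hx y)

lemma nilp_of_LN (h : MaxAb G) (hL : LN G) : Group.IsNilpotent G := by
  refine nilp_of_center (sn_W h _ le_rfl) ?_
  intro n hn hnt
  have hs : Function.Surjective (QuotientGroup.mk' (Subgroup.upperCentralSeries G n)) :=
    QuotientGroup.mk'_surjective _
  set π := QuotientGroup.mk' (Subgroup.upperCentralSeries G n) with hπ
  have hker : ∀ g, π g = 1 → g ∈ Subgroup.upperCentralSeries G n :=
    fun g hg => (QuotientGroup.eq_one_iff g).1 hg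
  refine center_ne_bot_of_LN ?_ ?_
  · intro H hH
    have hB : Group.IsNilpotent (H.comap π) := by
      refine ⟨n + 1, ?_⟩
      rw [eq_top_iff]
      intro x _ y
      apply ucs_subgroupOf
      apply hker
      have : π (((⁅x, y⁆ : H.comap π)) : G) = ⁅π x, π y⁆ := by
        rw [← map_commutatorElement]; rfl
      rw [this, commutatorElement_eq_one_iff_mul_comm]
      exact hH _ x.2 _ y.2
    have := fg_map (sn_of_nilp h _ hB _ le_rfl) π
    rwa [map_comap_eq_self_of_surjective hs] at this
  · intro H hH
    obtain ⟨M, -, hM, rfl⟩ := fg_lift π ⊤ H hH (by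
      rw [← MonoidHom.range_eq_map, MonoidHom.range_eq_top.2 hs]; exact le_top)
    exact nilp_map (hL M hM) π


lemma exists_central_of_normal [Group.IsNilpotent G] {N : Subgroup G} (hN : N.Normal) (h : N ≠ ⊥) :
    ∃ z ∈ N, z ≠ 1 ∧ z ∈ center G := by
  by_contra! hcon
  have key : ∀ k, ∀ x ∈ N, x ∈ Subgroup.upperCentralSeries G k → x = 1 := by
    intro k
    induction k with
    | zero =>
      intro x _ hx
      simpa using hx
    | succ k ih =>
      intro x hxN hx
      by_contra hne
      apply hcon x hxN hne
      rw [mem_center_iff]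
      intro g
      have h1 := (Subgroup.mem_upperCentralSeries_succ_iff.1 hx) g
      have h2 : x * g * x⁻¹ * g⁻¹ ∈ N := by
        have := mul_mem hxN (hN.conj_mem _ (inv_mem hxN) g)
        simpa [mul_assoc] using this
      have h3 := ih _ h2 h1
      have : x * g = g * x := by
        calc x * g = (x * g * x⁻¹ * g⁻¹) * (g * x) := by group
          _ = g * x := by rw [h3, one_mul]
      exact this.symm
  obtain ⟨n, hn⟩ := Group.IsNilpotent.nilpotent G
  apply h
  rw [eq_bot_iff]
  intro x hx
  exact mem_bot.2 (key n x hx (hn ▸ mem_top x))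

lemma exists_comm_of_pair {Z : Subgroup G} (hZ : Z.Normal) {r w : G} (hr : r ∈ Z) (hr1 : r ≠ 1)
    (h : Group.IsNilpotent (closure {r, w})) : ∃ z ∈ Z, z ≠ 1 ∧ z * w = w * z := by
  have hrK : r ∈ closure {r, w} := Subgroup.subset_closure (by simp)
  have hwK : w ∈ closure {r, w} := Subgroup.subset_closure (by simp)
  obtain ⟨z, hz, hz1, hzc⟩ := exists_central_of_normal (G := closure {r, w})
    (N := Z.subgroupOf (closure {r, w})) inferInstance (by
      intro hb
      have : (⟨r, hrK⟩ : closure {r, w}) ∈ Z.subgroupOf (closure {r, w}) := mem_subgroupOf.2 hr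
      rw [hb, mem_bot] at this
      exact hr1 (congrArg Subtype.val this))
  refine ⟨z, mem_subgroupOf.1 hz, fun e => hz1 (Subtype.ext e), ?_⟩
  exact (congrArg Subtype.val (mem_center_iff.1 hzc ⟨w, hwK⟩)).symm

lemma PSq.swap (h : PSq G) (x y : G) : Group.IsNilpotent (closure {x ^ 2, y}) := by
  rw [Set.pair_comm]; exact h y x

lemma exists_comm_of_psq (h : PSq G) {Z : Subgroup G} (hZ : Z.Normal)
    (hc : ∀ x ∈ Z, ∀ y ∈ Z, x * y = y * x) (hne : Z ≠ ⊥) (v : G) :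
    ∃ z ∈ Z, z ≠ 1 ∧ z * v = v * z := by
  obtain ⟨r, hr, hr1⟩ := (Subgroup.ne_bot_iff_exists_ne_one).1 hne |>.elim
    fun a ha => (⟨a.1, a.2, fun e => ha (Subtype.ext e)⟩ : ∃ r ∈ Z, r ≠ 1)
  obtain ⟨s, hs, hs1, hsv⟩ := exists_comm_of_pair hZ hr hr1 (h r v)
  by_cases h2 : s ^ 2 = 1
  · by_cases h3 : s * (v * s * v⁻¹) = 1
    · refine ⟨s, hs, hs1, ?_⟩
      have e : s * s = 1 := by rw [← pow_two]; exact h2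
      have : s = v * s * v⁻¹ := mul_left_cancel (e.trans h3.symm)
      calc s * v = (v * s * v⁻¹) * v := by rw [← this]
        _ = v * s := by group
    · refine ⟨_, mul_mem hs (hZ.conj_mem s hs v), h3, ?_⟩
      have h4 : v * (v * s * v⁻¹) * v⁻¹ = s := by
        calc _ = (v ^ 2 * s) * (v ^ 2)⁻¹ := by rw [pow_two]; group
          _ = s := by rw [← hsv]; group
      have h5 := hc _ hs _ (hZ.conj_mem s hs v)
      calc s * (v * s * v⁻¹) * v = (v * (v * s * v⁻¹) * v⁻¹) * (v * s * v⁻¹) * v := by rw [h4]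
        _ = v * ((v * s * v⁻¹) * s) := by group
        _ = _ := by rw [h5]
  · exact exists_comm_of_pair hZ (pow_mem hs 2) h2 (h.swap s v)

lemma sn_zpowers (v : G) : SN (zpowers v) := by
  intro K hK
  have : IsCyclic K := Subgroup.isCyclic_of_le hK
  obtain ⟨g, hg⟩ := (Subgroup.isCyclic_iff_exists_zpowers_eq_top K).1 this
  rw [← hg]
  exact ⟨{g}, by simp [zpowers_eq_closure]⟩

lemma nilp_X (hP : PSq G) {U : Subgroup G} (hN : U.Normal) (hU : Group.IsNilpotent U)
    (hs : SN U) {v : G} (ht : U ⊔ zpowers v = ⊤) : Group.IsNilpotent G := by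
  have hfg : (W G).FG := by
    apply fg_ext (QuotientGroup.mk' U)
    · apply (sn_zpowers (QuotientGroup.mk' U v))
      rw [← MonoidHom.map_zpowers]
      have : (zpowers v).map (QuotientGroup.mk' U) = ⊤ := by
        rw [← Subgroup.map_top_of_surjective _ (QuotientGroup.mk'_surjective U), ← ht,
          Subgroup.map_sup, QuotientGroup.map_mk'_self, bot_sup_eq]
      rw [this]; exact le_top
    · apply hs
      rw [QuotientGroup.ker_mk']
      exact inf_le_right
  refine nilp_of_center hfg ?_
  intro n _ hnt
  have hsu : Function.Surjective (QuotientGroup.mk' (Subgroup.upperCentralSeries G n)) :=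
    QuotientGroup.mk'_surjective _
  set π := QuotientGroup.mk' (Subgroup.upperCentralSeries G n)
  have hPQ := hP.of_surjective hsu
  have hT : U.map π ⊔ zpowers (π v) = ⊤ := by
    rw [← MonoidHom.map_zpowers, ← Subgroup.map_sup, ht, Subgroup.map_top_of_surjective _ hsu]
  have hcent : ∀ z, (∀ u ∈ U.map π, u * z = z * u) → z * π v = π v * z → z ∈ center _ := by
    intro z h1 h2
    have : U.map π ⊔ zpowers (π v) ≤ centralizer {z} := by
      refine sup_le ?_ ?_
      · intro u hu
        exact mem_centralizer_singleton_iff.2 (h1 u hu)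
      · rw [zpowers_le]
        exact mem_centralizer_singleton_iff.2 h2.symm
    rw [hT] at this
    rw [mem_center_iff]
    intro g
    exact mem_centralizer_singleton_iff.1 (this (mem_top g))
  have hUn : (U.map π).Normal := hN.map π hsu
  by_cases hb : U.map π = ⊥
  · have hpv : π v ∈ center _ := hcent (π v) (by
      intro u hu; rw [hb, mem_bot] at hu; simp [hu]) rfl
    intro hbot
    rw [hbot, mem_bot] at hpv
    rw [hb, hpv] at hT
    simp at hT
  · have hnU := nilp_map hU π
    have : Nontrivial (U.map π) := (Subgroup.nontrivial_iff_ne_bot _).2 hb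
    have hcn : center (U.map π) ≠ ⊥ := Group.IsNilpotent.center_ne_bot _
    obtain ⟨⟨c, hc⟩, hc1⟩ := (Subgroup.ne_bot_iff_exists_ne_one).1 hcn
    obtain ⟨z, hz, hz1, hzv⟩ := exists_comm_of_psq hPQ
      (Z := U.map π ⊓ centralizer (U.map π : Set _)) inferInstance (by
        intro x hx y hy
        exact mem_centralizer_iff.1 (mem_inf.1 hy).2 x (mem_inf.1 hx).1) (by
        intro hbot
        have : (c : G ⧸ _) ∈ U.map π ⊓ centralizer (U.map π : Set _) := by
          refine mem_inf.2 ⟨c.2, mem_centralizer_iff.2 fun u hu => ?_⟩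
          exact congrArg Subtype.val (mem_center_iff.1 hc ⟨u, hu⟩)
        rw [hbot, mem_bot] at this
        exact hc1 (Subtype.ext (Subtype.ext this))) (π v)
    intro hbot
    have := hcent z (fun u hu => mem_centralizer_iff.1 (mem_inf.1 hz).2 u hu) hzv
    rw [hbot, mem_bot] at this
    exact hz1 this

lemma nilp_X' (hP : PSq G) {U : Subgroup G} (hU : Group.IsNilpotent U)
    (hs : SN U) {v : G} (hv : v ∈ normalizer (U : Set G)) :
    Group.IsNilpotent (U ⊔ zpowers v : Subgroup G) := by
  set H := U ⊔ zpowers v with hH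
  have hUH : U ≤ H := le_sup_left
  have hvH : zpowers v ≤ H := le_sup_right
  have hHN : H ≤ normalizer (U : Set G) := sup_le le_normalizer (zpowers_le.2 hv)
  refine nilp_X (G := H) (U := U.subgroupOf H) (v := ⟨v, hvH (mem_zpowers v)⟩)
    (hP.of_injective H.subtype_injective) ?_ ?_ ?_ ?_
  · exact (normal_subgroupOf_iff_le_normalizer hUH).2 hHN
  · exact (Group.isNilpotent_congr (subgroupOfEquivOfLe hUH)).2 hU
  · exact hs.comap H.subtype_injective
  · apply Subgroup.map_injective H.subtype_injective
    rw [Subgroup.map_sup, MonoidHom.map_zpowers, subgroupOf_map_subtype, inf_eq_left.2 hUH,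
      ← MonoidHom.range_eq_map, range_subtype]
    rfl

lemma exists_common_comm {K : Subgroup G} (hK : Group.IsNilpotent K) {u : G} (hu : u ∈ K)
    (hu1 : u ≠ 1) : ∃ z : G, z ≠ 1 ∧ ∀ x ∈ K, z * x = x * z := by
  have : Nontrivial K := ⟨⟨⟨u, hu⟩, 1, fun e => hu1 (congrArg Subtype.val e)⟩⟩
  have hcn : center K ≠ ⊥ := Group.IsNilpotent.center_ne_bot _
  obtain ⟨⟨c, hc⟩, hc1⟩ := (Subgroup.ne_bot_iff_exists_ne_one).1 hcn
  refine ⟨c, fun e => hc1 (Subtype.ext (Subtype.ext e)), fun x hx => ?_⟩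
  exact (congrArg Subtype.val (mem_center_iff.1 hc ⟨x, hx⟩)).symm

lemma lemma_D (hP : PSq G) {u v : G} (hu : u ≠ 1) (hv : v ≠ 1) :
    ∃ u' ∈ zpowers u, ∃ v' ∈ zpowers v, u' ≠ 1 ∧ v' ≠ 1 ∧
      ∃ z : G, z ≠ 1 ∧ z * u' = u' * z ∧ z * v' = v' * z := by
  by_cases hu2 : u ^ 2 = 1
  · by_cases hv2 : v ^ 2 = 1
    · have huu : u⁻¹ = u := inv_eq_of_mul_eq_one_left (by rw [← pow_two]; exact hu2)
      have hvv : v⁻¹ = v := inv_eq_of_mul_eq_one_left (by rw [← pow_two]; exact hv2)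
      have hn : u ∈ normalizer (zpowers (u * v) : Set G) := by
        have e : ∀ n : ℤ, u * (u * v) ^ n * u⁻¹ = (u * v) ^ (-n) := by
          intro n
          rw [← conj_zpow, zpow_neg, ← inv_zpow]
          congr 1
          rw [mul_inv_rev, hvv, huu]
          calc u * (u * v) * u = (u ^ 2) * v * u := by rw [pow_two]; group
            _ = v * u := by rw [hu2, one_mul]
        rw [mem_normalizer_iff]
        intro h
        constructor
        · rintro ⟨n, rfl⟩
          exact ⟨-n, (e n).symm⟩
        · rintro ⟨n, hn⟩
          refine ⟨-n, ?_⟩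
          have hn' : (u * v) ^ n = u * h * u⁻¹ := hn
          have := e n
          rw [hn'] at this
          change (u * v) ^ (-n) = h
          rw [← this]
          calc _ = (u ^ 2) * h * (u ^ 2)⁻¹ := by rw [pow_two]; group
            _ = h := by rw [hu2]; simp
      have hnil := nilp_X' hP (nilp_of_comm (A := zpowers (u * v)) (by
        rintro _ ⟨n, rfl⟩ _ ⟨m, rfl⟩
        exact zpow_mul_comm _ _ _)) (sn_zpowers _) hn
      have hU : u ∈ zpowers (u * v) ⊔ zpowers u := (le_sup_right : zpowers u ≤ _) (mem_zpowers u)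
      have hV : v ∈ zpowers (u * v) ⊔ zpowers u := by
        have := mul_mem (inv_mem hU)
          ((le_sup_left : zpowers (u * v) ≤ zpowers (u * v) ⊔ zpowers u) (mem_zpowers _))
        simpa using this
      obtain ⟨z, hz1, hz⟩ := exists_common_comm hnil hU hu
      exact ⟨u, mem_zpowers u, v, mem_zpowers v, hu, hv, z, hz1, hz u hU, hz v hV⟩
    · have hU : u ∈ closure {u, v ^ 2} := Subgroup.subset_closure (by simp)
      have hV : v ^ 2 ∈ closure {u, v ^ 2} := Subgroup.subset_closure (by simp)
      obtain ⟨z, hz1, hz⟩ := exists_common_comm (hP u v) hU hu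
      exact ⟨u, mem_zpowers u, v ^ 2, npow_mem_zpowers v 2, hu, hv2, z, hz1, hz _ hU, hz _ hV⟩
  · have hU : u ^ 2 ∈ closure {v, u ^ 2} := Subgroup.subset_closure (by simp)
    have hV : v ∈ closure {v, u ^ 2} := Subgroup.subset_closure (by simp)
    obtain ⟨z, hz1, hz⟩ := exists_common_comm (hP v u) hV hv
    exact ⟨u ^ 2, npow_mem_zpowers u 2, v, mem_zpowers v, hu2, hv, z, hz1, hz _ hU, hz _ hV⟩

lemma sSup_mem_of_chain (h : MaxAb G) {c : Set (Subgroup G)} (hne : c.Nonempty)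
    (hch : IsChain (· ≤ ·) c) (hc : ∀ U ∈ c, Group.IsNilpotent U) : sSup c ∈ c := by
  have : Nonempty c := hne.to_subtype
  have hd : Directed (· ≤ ·) (fun i : c => (i : Subgroup G)) :=
    directedOn_iff_directed.1 hch.directedOn
  have hS : sSup c = ⨆ i : c, (i : Subgroup G) := sSup_eq_iSup' c
  have hnil : Group.IsNilpotent (sSup c : Subgroup G) := by
    apply nilp_of_LN (h.of_injective (sSup c).subtype_injective)
    intro H hH
    have h1 : (H.map (sSup c).subtype) ≤ ⨆ i : c, (i : Subgroup G) := by
      rw [← hS]; exact map_subtype_le H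
    obtain ⟨i, hi⟩ := fg_le_iSup hd (fg_map hH _) h1
    exact nilp_of_map (sSup c).subtype_injective (nilp_of_le (hc i i.2) hi)
  obtain ⟨i, hi⟩ := fg_le_iSup hd (sn_of_nilp h _ hnil _ le_rfl) hS.le
  have : sSup c = i := le_antisymm hi (le_sSup i.2)
  rw [this]; exact i.2

lemma exists_maximal_nilp (h : MaxAb G) (p : Subgroup G → Prop)
    (hp : ∀ U, p U → Group.IsNilpotent U) {U : Subgroup G} (hU : p U) :
    ∃ M, U ≤ M ∧ Maximal p M := by
  obtain ⟨M, h1, hM⟩ := zorn_le_nonempty₀ {U | p U} (by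
    intro c hc hch y hy
    exact ⟨sSup c, hc (sSup_mem_of_chain h ⟨y, hy⟩ hch fun U hU => hp U (hc hU)),
      fun s hs => le_sSup hs⟩) U hU
  exact ⟨M, h1, hM⟩

lemma exists_normalizing {I U : Subgroup G} (hU : Group.IsNilpotent U) (hIU : I < U) :
    ∃ u ∈ U, u ∉ I ∧ u ∈ normalizer (I : Set G) := by
  have h1 : I.subgroupOf U < ⊤ := by
    rw [lt_top_iff_ne_top, Ne, subgroupOf_eq_top]
    exact not_le_of_gt hIU
  have h2 := Group.normalizerCondition_of_isNilpotent (G := U) _ h1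
  obtain ⟨u, hu, hu'⟩ := SetLike.exists_of_lt h2
  refine ⟨u, u.2, fun e => hu' (mem_subgroupOf.2 e), ?_⟩
  rw [mem_normalizer_iff] at hu ⊢
  intro g
  constructor
  · intro hg
    exact mem_subgroupOf.1 ((hu ⟨g, hIU.le hg⟩).1 (mem_subgroupOf.2 hg))
  · intro hg
    have hgU : g ∈ U := by
      have := mul_mem (mul_mem (inv_mem u.2) (hIU.le hg)) u.2
      simpa [mul_assoc] using this
    exact mem_subgroupOf.1 ((hu ⟨g, hgU⟩).2 (mem_subgroupOf.2 hg))

lemma normalizes_sup {I : Subgroup G} {z u : G} (hz : z ∈ normalizer (I : Set G))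
    (hu : u ∈ normalizer (I : Set G)) (hzu : (z * u)⁻¹ * (u * z) ∈ I) :
    u ∈ normalizer ((I ⊔ zpowers z : Subgroup G) : Set G) := by
  set H := I ⊔ zpowers z with hH
  have hIH : I ≤ H := le_sup_left
  have hzH : z ∈ H := (le_sup_right : zpowers z ≤ H) (mem_zpowers z)
  have hnI : ∀ g ∈ normalizer (I : Set G), ∀ i ∈ I, g * i * g⁻¹ ∈ I :=
    fun g hg i hi => (mem_normalizer_iff.1 hg i).1 hi
  -- conjugation by `u` and by its inverse both preserve `H`
  have step : ∀ w ∈ normalizer (I : Set G), w * z * w⁻¹ ∈ H → ∀ g ∈ H, w * g * w⁻¹ ∈ H := by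
    intro w hw hwz
    have : H ≤ H.comap (MulAut.conj w).toMonoidHom := by
      refine sup_le ?_ ?_
      · intro i hi
        exact hIH (hnI w hw i hi)
      · rw [zpowers_le]
        exact hwz
    exact fun g hg => this hg
  have h1 : u * z * u⁻¹ ∈ H := by
    have e : u * z * u⁻¹ = z * (u * ((z * u)⁻¹ * (u * z)) * u⁻¹) := by group
    rw [e]
    exact mul_mem hzH (hIH (hnI u hu _ hzu))
  have h2 : u⁻¹ * z * u⁻¹⁻¹ ∈ H := by
    have e : u⁻¹ * z * u⁻¹⁻¹ = z * ((z * u)⁻¹ * (u * z))⁻¹ := by group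
    rw [e]
    exact mul_mem hzH (hIH (inv_mem hzu))
  rw [mem_normalizer_iff]
  intro g
  refine ⟨step u hu h1 g, fun hg => ?_⟩
  have := step u⁻¹ (inv_mem hu) h2 _ hg
  simpa [mul_assoc] using this

theorem nilp_main (hP : PSq G) (h : MaxAb G) : Group.IsNilpotent G := by
  let p : Subgroup G → Prop := fun U => Group.IsNilpotent U
  have hex : ∀ U : Subgroup G, Group.IsNilpotent U → ∃ M, U ≤ M ∧ Maximal p M :=
    fun U hU => exists_maximal_nilp h p (fun _ h => h) hU
  by_cases hall : ∀ U V, Maximal p U → Maximal p V → U = V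
  · obtain ⟨U, -, hU⟩ := hex ⊥ (nilp_of_comm (by
      intro x hx y hy; rw [mem_bot] at hx hy; rw [hx, hy]))
    have : U = ⊤ := by
      rw [eq_top_iff]
      intro g _
      obtain ⟨V, hgV, hV⟩ := hex (zpowers g) (nilp_of_comm (by
        rintro _ ⟨n, rfl⟩ _ ⟨m, rfl⟩
        exact zpow_mul_comm _ _ _))
      rw [hall U V hU hV]
      exact hgV (mem_zpowers g)
    have hUn : Group.IsNilpotent U := hU.prop
    rw [this] at hUn
    exact Group.isNilpotent_top.1 hUn
  exfalso
  push Not at hall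
  obtain ⟨U₀, V₀, hU₀, hV₀, hne₀⟩ := hall
  let q : Subgroup G → Prop := fun I => ∃ U V, Maximal p U ∧ Maximal p V ∧ U ≠ V ∧ U ⊓ V = I
  obtain ⟨I, -, hI⟩ := exists_maximal_nilp h q (by
    rintro _ ⟨U, V, hU, -, -, rfl⟩
    exact nilp_of_le hU.prop inf_le_left) (U := U₀ ⊓ V₀) ⟨U₀, V₀, hU₀, hV₀, hne₀, rfl⟩
  obtain ⟨U, V, hU, hV, hUV, hIe⟩ := hI.prop
  have hUn : Group.IsNilpotent U := hU.prop
  have hVn : Group.IsNilpotent V := hV.prop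
  have hIU : I < U := by
    refine lt_of_le_of_ne (hIe ▸ inf_le_left) fun e => hUV ?_
    have : U ≤ V := by rw [← inf_eq_left, hIe, e]
    exact le_antisymm this (hU.le_of_ge hVn this)
  have hIV : I < V := by
    refine lt_of_le_of_ne (hIe ▸ inf_le_right) fun e => hUV ?_
    have : V ≤ U := by rw [← inf_eq_right, hIe, e]
    exact le_antisymm (hV.le_of_ge hUn this) this
  have hIn : Group.IsNilpotent I := nilp_of_le hUn hIU.le
  obtain ⟨u, huU, huI, huN⟩ := exists_normalizing hUn hIU
  obtain ⟨v, hvV, hvI, hvN⟩ := exists_normalizing hVn hIV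
  set N := normalizer (I : Set G) with hN
  have hnorm : (I.subgroupOf N).Normal := normal_in_normalizer
  let π := QuotientGroup.mk' (I.subgroupOf N)
  have hsu : Function.Surjective π := QuotientGroup.mk'_surjective _
  have hPQ : PSq (N ⧸ I.subgroupOf N) :=
    (hP.of_injective N.subtype_injective).of_surjective (f := π) hsu
  have h1 : ∀ x : N, π x = 1 ↔ (x : G) ∈ I := by
    intro x
    rw [← mem_subgroupOf]
    exact QuotientGroup.eq_one_iff x
  obtain ⟨u', hu', v', hv', hu1, hv1, z, hz1, hzu, hzv⟩ := lemma_D hPQ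
    (u := π ⟨u, huN⟩) (v := π ⟨v, hvN⟩) (fun e => huI ((h1 _).1 e)) (fun e => hvI ((h1 _).1 e))
  obtain ⟨z, rfl⟩ := hsu z
  have hzI : (z : G) ∉ I := fun e => hz1 ((h1 _).2 e)
  have key : ∀ U : Subgroup G, Maximal p U → I < U → ∀ u (huN : u ∈ N), u ∈ U →
      ∀ u' ∈ zpowers (π ⟨u, huN⟩), u' ≠ 1 → π z * u' = u' * π z → (z : G) ∈ U := by
    rintro U hU hIU u huN huU _ ⟨n, rfl⟩ hu1 hzu
    set w : N := ⟨u, huN⟩ ^ n with hw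
    have hwe : (π ⟨u, huN⟩) ^ n = π w := (map_zpow π _ _).symm
    have hu1' : π w ≠ 1 := hwe ▸ hu1
    have hzu' : π z * π w = π w * π z := hwe ▸ hzu
    have hwI : (w : G) ∉ I := fun e => hu1' ((h1 _).2 e)
    have hwU : (w : G) ∈ U := by
      rw [hw]; exact zpow_mem huU n
    have hcI : ((z : G) * w)⁻¹ * (w * z) ∈ I := by
      refine (h1 ((z * w)⁻¹ * (w * z))).1 ?_
      rw [map_mul, map_inv, map_mul, map_mul, hzu']
      simp
    have n1 := nilp_X' hP hIn (sn_of_nilp h I hIn) z.2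
    have n2 := nilp_X' hP n1 (sn_of_nilp h _ n1) (normalizes_sup z.2 w.2 hcI)
    obtain ⟨M, hM, hMm⟩ := hex _ n2
    have hIM : I ≤ M := (le_sup_left.trans le_sup_left).trans hM
    have hzM : (z : G) ∈ M :=
      ((le_sup_right.trans le_sup_left : zpowers (z : G) ≤ _).trans hM) (mem_zpowers _)
    have hwM : (w : G) ∈ M :=
      ((le_sup_right : zpowers (w : G) ≤ _).trans hM) (mem_zpowers _)
    by_cases hMU : M = U
    · exact hMU ▸ hzM
    · exfalso
      have hq : q (M ⊓ U) := ⟨M, U, hMm, hU, hMU, rfl⟩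
      exact hwI (hI.le_of_ge hq (le_inf hIM hIU.le) (mem_inf.2 ⟨hwM, hwU⟩))
  apply hzI
  rw [← hIe]
  exact mem_inf.2 ⟨key U hU hIU u huN huU u' hu' hu1 hzu, key V hV hIV v hvN hvV v' hv' hv1 hzv⟩

end N3

theorem stmt_9 {G : Type*} [Group G] (h : CondN3 G)
    (hmax : ∀ f : ℕ → Subgroup G, Monotone f →
      (∀ n, ∀ x ∈ f n, ∀ y ∈ f n, x * y = y * x) →
      ∃ n, ∀ m, n ≤ m → f m = f n) :
    Group.IsNilpotent G :=
  N3.nilp_main (N3.psq_of_condN3 h) (N3.maxAb_of_chain hmax)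
end
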